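/- Let f be a Rademacher random multiplicative function. For ℓ ≥ 2 and T ≥ 1 define the event Σ_ℓ := { ∫_{−∞}^{+∞} |S_{X_{ℓ−1}}(1/2+it)|² / |1/2+it|² dt ≤ √T · 2^{(ℓ−1)^K} / √((ℓ−1)^K) }, where S_x(1/2+it) := ∏_{p ≤ x, p prime} (1 + f(p)·p^{−1/2−it}). There exists a constant C = C(ε) > 0 such that for every T ≥ 1 and every sufficiently large ℓ (in terms of ε), ℙ(complement of Σ_ℓ) ≤ C · T^{−1/4}. -/

import Mathlib

open MeasureTheory ProbabilityTheory

noncomputable section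

/-- A Rademacher random multiplicative function. -/
structure IsRademacherRMF {Ω : Type*} [MeasurableSpace Ω] (μ : Measure Ω)
    (f : Ω → ℕ → ℝ) : Prop where
  meas : ∀ n : ℕ, Measurable fun ω => f ω n
  indep : iIndepFun
    (fun (p : Nat.Primes) (ω : Ω) => f ω (p : ℕ)) μ
  prob_one : ∀ p : ℕ, p.Prime → μ {ω | f ω p = 1} = 1 / 2
  prob_neg_one : ∀ p : ℕ, p.Prime → μ {ω | f ω p = -1} = 1 / 2
  eq_zero_of_not_squarefree : ∀ (ω : Ω) (n : ℕ), ¬Squarefree n → f ω n = 0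
  eq_prod_of_squarefree : ∀ (ω : Ω) (n : ℕ), Squarefree n →
    f ω n = ∏ p ∈ n.primeFactors, f ω p

/-- `X_ℓ := exp(2^{ℓ^K})` with `K = 1/(4ε)` (here `ℓ` is a real number). -/
def Xpt (ε ℓ : ℝ) : ℝ := Real.exp ((2 : ℝ) ^ (ℓ ^ (1 / (4 * ε))))

/-- The truncated Euler product `S_x(1/2+it) = ∏_{p ≤ x} (1 + f(p) p^{-1/2-it})`. -/
def eulerProd {Ω : Type*} (f : Ω → ℕ → ℝ) (ω : Ω) (x : ℝ) (t : ℝ) : ℂ :=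
  ∏ p ∈ (Finset.Icc 1 ⌊x⌋₊).filter Nat.Prime,
    (1 + (f ω p : ℂ) * (p : ℂ) ^ (-(1 / 2 : ℂ) - (t : ℂ) * Complex.I))


/-- Expectation over independent coordinates `b i`, `i < n`, with `P (b i = true) = w i`. -/
def Ex (w : ℕ → ℝ) : ℕ → ((ℕ → Bool) → ℝ) → ℝ
  | 0, g => g (fun _ => false)
  | n + 1, g => Ex w n (fun b =>
      w n * g (Function.update b n true) + (1 - w n) * g (Function.update b n false))

/-- `g` depends only on the coordinates below `n`. -/
def Dep {α : Type*} (n : ℕ) (g : (ℕ → Bool) → α) : Prop :=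
  ∀ b b' : ℕ → Bool, (∀ i < n, b i = b' i) → g b = g b'

theorem Dep.mono {α : Type*} {n m : ℕ} {g : (ℕ → Bool) → α} (h : Dep n g) (hnm : n ≤ m) :
    Dep m g := fun b b' hb => h b b' fun i hi => hb i (hi.trans_le hnm)

theorem Dep.update {α : Type*} {n : ℕ} {g : (ℕ → Bool) → α} (h : Dep n g) {m : ℕ} (hm : n ≤ m)
    (b : ℕ → Bool) (x : Bool) : g (Function.update b m x) = g b :=
  h _ _ fun i hi => Function.update_of_ne (by omega) _ _

theorem Dep.comp {α β : Type*} {n : ℕ} {g : (ℕ → Bool) → α} (h : Dep n g) (φ : α → β) :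
    Dep n (fun b => φ (g b)) := fun b b' hb => by
  show φ (g b) = φ (g b'); rw [h b b' hb]

theorem Dep.comp₂ {α β γ : Type*} {n : ℕ} {g : (ℕ → Bool) → α} {g' : (ℕ → Bool) → β}
    (h : Dep n g) (h' : Dep n g') (φ : α → β → γ) :
    Dep n (fun b => φ (g b) (g' b)) := fun b b' hb => by
  show φ (g b) (g' b) = φ (g b') (g' b'); rw [h b b' hb, h' b b' hb]

theorem Ex_add (w : ℕ → ℝ) (n : ℕ) (g h : (ℕ → Bool) → ℝ) :
    Ex w n (fun b => g b + h b) = Ex w n g + Ex w n h := by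
  induction n generalizing g h with
  | zero => rfl
  | succ n ih =>
    simp only [Ex]
    rw [← ih]
    congr 1; funext b; ring

theorem Ex_mul_left (w : ℕ → ℝ) (n : ℕ) (c : ℝ) (g : (ℕ → Bool) → ℝ) :
    Ex w n (fun b => c * g b) = c * Ex w n g := by
  induction n generalizing g with
  | zero => rfl
  | succ n ih =>
    simp only [Ex]
    rw [← ih]
    congr 1; funext b; ring

theorem Ex_sub (w : ℕ → ℝ) (n : ℕ) (g h : (ℕ → Bool) → ℝ) :
    Ex w n (fun b => g b - h b) = Ex w n g - Ex w n h := by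
  have := Ex_add w n g (fun b => (-1) * h b)
  rw [Ex_mul_left] at this
  rw [show Ex w n g - Ex w n h = Ex w n g + (-1) * Ex w n h by ring, ← this]
  congr 1; funext b; ring

theorem Ex_const (w : ℕ → ℝ) (n : ℕ) (c : ℝ) : Ex w n (fun _ => c) = c := by
  induction n with
  | zero => rfl
  | succ n ih => 
    simp only [Ex]
    rw [← ih]; congr 1; funext b; rw [ih]; ring

theorem Ex_sum {ι : Type*} (w : ℕ → ℝ) (n : ℕ) (s : Finset ι) (g : ι → (ℕ → Bool) → ℝ) :
    Ex w n (fun b => ∑ i ∈ s, g i b) = ∑ i ∈ s, Ex w n (g i) := by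
  classical
  induction s using Finset.induction_on with
  | empty => simp [Ex_const]
  | insert a s ha ih => 
    simp only [Finset.sum_insert ha]
    rw [Ex_add, ih]

theorem Ex_mono {w : ℕ → ℝ} (hw0 : ∀ i, 0 ≤ w i) (hw1 : ∀ i, w i ≤ 1) (n : ℕ)
    {g h : (ℕ → Bool) → ℝ} (hgh : ∀ b, g b ≤ h b) : Ex w n g ≤ Ex w n h := by
  induction n generalizing g h with
  | zero => exact hgh _
  | succ n ih =>
    simp only [Ex]
    apply ih
    intro b
    have h1 := mul_le_mul_of_nonneg_left (hgh (Function.update b n true)) (hw0 n)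
    have h2 := mul_le_mul_of_nonneg_left (hgh (Function.update b n false))
      (sub_nonneg.2 (hw1 n))
    linarith

theorem Ex_nonneg {w : ℕ → ℝ} (hw0 : ∀ i, 0 ≤ w i) (hw1 : ∀ i, w i ≤ 1) (n : ℕ)
    {g : (ℕ → Bool) → ℝ} (hg : ∀ b, 0 ≤ g b) : 0 ≤ Ex w n g := by
  have := Ex_mono hw0 hw1 n hg
  rwa [Ex_const] at this

theorem Ex_succ_of_dep (w : ℕ → ℝ) {n : ℕ} {g : (ℕ → Bool) → ℝ} (hg : Dep n g) :
    Ex w (n + 1) g = Ex w n g := by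
  simp only [Ex]
  congr 1; funext b
  rw [hg.update le_rfl, hg.update le_rfl]; ring

theorem Ex_stable (w : ℕ → ℝ) {n N : ℕ} (hnN : n ≤ N) {g : (ℕ → Bool) → ℝ} (hg : Dep n g) :
    Ex w N g = Ex w n g := by
  induction N, hnN using Nat.le_induction with
  | base => rfl
  | succ m hm ih => rw [Ex_succ_of_dep w (hg.mono hm), ih]

/-- A product of a function of coordinate `i` and a function of earlier coordinates. -/
theorem Ex_mul_coord (w : ℕ → ℝ) {i N : ℕ} (hi : i < N) {g : (ℕ → Bool) → ℝ} (hg : Dep i g)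
    (X : Bool → ℝ) :
    Ex w N (fun b => X (b i) * g b) = (w i * X true + (1 - w i) * X false) * Ex w N g := by
  have hd : Dep (i + 1) (fun b => X (b i) * g b) := by
    intro b b' hb
    simp only [hb i (by omega), hg b b' fun j hj => hb j (by omega)]
  rw [Ex_stable w (Nat.succ_le_of_lt hi) hd, Ex_stable w hi.le hg]
  simp only [Ex]
  rw [← Ex_mul_left]
  congr 1; funext b
  rw [hg.update le_rfl, hg.update le_rfl]; simp; ring

/-- Product formula. -/
theorem Ex_prod (w : ℕ → ℝ) (n : ℕ) (X : ℕ → Bool → ℝ) :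
    Ex w n (fun b => ∏ i ∈ Finset.range n, X i (b i)) =
      ∏ i ∈ Finset.range n, (w i * X i true + (1 - w i) * X i false) := by
  induction n with
  | zero => simp [Ex]
  | succ n ih =>
    have hd : Dep n (fun b : ℕ → Bool => ∏ i ∈ Finset.range n, X i (b i)) := by
      intro b b' hb
      apply Finset.prod_congr rfl
      intro i hi
      rw [hb i (Finset.mem_range.1 hi)]
    have := Ex_mul_coord w (Nat.lt_succ_self n) hd (X n)
    rw [Finset.prod_range_succ, ← ih, mul_comm, ← Ex_succ_of_dep w hd, ← this]
    congr 1; funext b; rw [Finset.prod_range_succ, mul_comm]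

/-- Change of measure. -/
theorem Ex_tilt (w0 w : ℕ → ℝ) (n : ℕ) (X : ℕ → Bool → ℝ) (c : ℕ → ℝ)
    (h1 : ∀ i, w0 i * X i true = c i * w i)
    (h2 : ∀ i, (1 - w0 i) * X i false = c i * (1 - w i)) (g : (ℕ → Bool) → ℝ) :
    Ex w0 n (fun b => (∏ i ∈ Finset.range n, X i (b i)) * g b) =
      (∏ i ∈ Finset.range n, c i) * Ex w n g := by
  induction n generalizing g with
  | zero => simp [Ex]
  | succ n ih =>
    have hd : Dep n (fun b : ℕ → Bool => ∏ i ∈ Finset.range n, X i (b i)) := by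
      intro b b' hb
      apply Finset.prod_congr rfl
      intro i hi
      rw [hb i (Finset.mem_range.1 hi)]
    simp only [Ex]
    rw [Finset.prod_range_succ, mul_assoc, ← Ex_mul_left, ← ih]
    congr 1; funext b
    rw [Finset.prod_range_succ, Finset.prod_range_succ]
    have e1 := hd.update le_rfl b true
    have e2 := hd.update le_rfl b false
    rw [e1, e2]
    simp only [Function.update_self]
    linear_combination (∏ i ∈ Finset.range n, X i (b i)) * g (Function.update b n true) * h1 n +
      (∏ i ∈ Finset.range n, X i (b i)) * g (Function.update b n false) * h2 n

/-- `g` is decreasing in each coordinate with respect to the orientation `o`. -/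
def Decr (o : ℕ → Bool) (g : (ℕ → Bool) → ℝ) : Prop :=
  ∀ b i, g (Function.update b i (o i)) ≤ g (Function.update b i (!o i))

theorem Harris {w : ℕ → ℝ} (hw0 : ∀ i, 0 ≤ w i) (hw1 : ∀ i, w i ≤ 1) (o : ℕ → Bool) (n : ℕ)
    {g h : (ℕ → Bool) → ℝ} (hg : Decr o g) (hh : Decr o h) :
    Ex w n g * Ex w n h ≤ Ex w n (fun b => g b * h b) := by
  induction n generalizing g h with
  | zero => exact le_rfl
  | succ n ih =>
    have key : ∀ g, Decr o g → Decr o (fun b =>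
      w n * g (Function.update b n true) + (1 - w n) * g (Function.update b n false)) := by
      intro g hg b i
      by_cases hi : i = n
      · subst hi; simp
      · simp only [Function.update_comm hi]
        have h1 := mul_le_mul_of_nonneg_left (hg (Function.update b n true) i) (hw0 n)
        have h2 := mul_le_mul_of_nonneg_left (hg (Function.update b n false) i)
          (sub_nonneg.2 (hw1 n))
        linarith
    simp only [Ex]
    refine (ih (key g hg) (key h hh)).trans ?_
    apply Ex_mono hw0 hw1
    intro b
    have hgb := hg b n
    have hhb := hh b n
    have hw : 0 ≤ w n * (1 - w n) := mul_nonneg (hw0 n) (sub_nonneg.2 (hw1 n))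
    have hp : 0 ≤ (g (Function.update b n true) - g (Function.update b n false)) *
        (h (Function.update b n true) - h (Function.update b n false)) := by
      cases ho : o n <;> rw [ho] at hgb hhb <;> simp at hgb hhb
      · exact mul_nonneg (by linarith) (by linarith)
      · exact mul_nonneg_of_nonpos_of_nonpos (by linarith) (by linarith)
    nlinarith [mul_nonneg hw hp]

/-- Maximal inequality for nonnegative supermartingales. -/
theorem Ex_maximal {w : ℕ → ℝ} (hw0 : ∀ i, 0 ≤ w i) (hw1 : ∀ i, w i ≤ 1)
    (Z : ℕ → (ℕ → Bool) → ℝ) (hZ0 : ∀ n b, 0 ≤ Z n b) (hdep : ∀ n, Dep n (Z n))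
    (hsup : ∀ n b, w n * Z (n + 1) (Function.update b n true) +
      (1 - w n) * Z (n + 1) (Function.update b n false) ≤ Z n b)
    (A z0 : ℝ) (hz0 : ∀ b, Z 0 b ≤ z0) (N : ℕ) :
    A * Ex w N (fun b => open Classical in if ∃ n ≤ N, A < Z n b then 1 else 0) ≤ z0 := by
  classical
  have key : ∀ N, Ex w N (fun b => if ∃ n ≤ N, A < Z n b then A else Z N b) ≤ z0 := by
    intro N
    induction N with
    | zero =>
      simp only [Ex]
      split_ifs with h
      · obtain ⟨n, hn, h⟩ := h
        have : n = 0 := by omega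
        subst this
        exact h.le.trans (hz0 _)
      · exact hz0 _
    | succ N ih =>
      refine le_trans ?_ ih
      have hev : Dep N (fun b => ∃ n ≤ N, A < Z n b) := by
        intro b b' hb
        simp only [eq_iff_iff]
        refine exists_congr fun n => and_congr_right fun hn => ?_
        rw [(hdep n) b b' fun i hi => hb i (by omega)]
      simp only [Ex]
      apply Ex_mono hw0 hw1
      intro b
      have e1 := hev.update le_rfl b true
      have e2 := hev.update le_rfl b false
      by_cases hb : ∃ n ≤ N, A < Z n b
      · have h1 : ∀ x, ∃ n ≤ N + 1, A < Z n (Function.update b N x) := by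
          intro x
          have : ∃ n ≤ N, A < Z n (Function.update b N x) := by
            cases x
            · rwa [e2]
            · rwa [e1]
          obtain ⟨n, hn, h⟩ := this
          exact ⟨n, by omega, h⟩
        rw [if_pos (h1 _), if_pos (h1 _), if_pos hb]
        linarith
      · rw [if_neg hb]
        refine le_trans ?_ (hsup N b)
        have h1 : ∀ x, (if ∃ n ≤ N + 1, A < Z n (Function.update b N x) then A
            else Z (N + 1) (Function.update b N x)) ≤ Z (N + 1) (Function.update b N x) := by
          intro x
          split_ifs with h
          · obtain ⟨n, hn, h⟩ := h
            rcases Nat.lt_or_ge n (N + 1) with hlt | hge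
            · exfalso
              have : ∃ n ≤ N, A < Z n (Function.update b N x) := ⟨n, by omega, h⟩
              cases x
              · rw [e2] at this; exact hb this
              · rw [e1] at this; exact hb this
            · have : n = N + 1 := by omega
              subst this; exact h.le
          · exact le_rfl
        have h2 := mul_le_mul_of_nonneg_left (h1 true) (hw0 N)
        have h3 := mul_le_mul_of_nonneg_left (h1 false) (sub_nonneg.2 (hw1 N))
        linarith
  refine le_trans ?_ (key N)
  rw [← Ex_mul_left]
  apply Ex_mono hw0 hw1
  intro b
  by_cases h : ∃ n ≤ N, A < Z n b
  · simp [h]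
  · simp [h, hZ0]


/-- The sign attached to a Boolean. -/
def sg (x : Bool) : ℝ := if x then 1 else -1

@[simp] theorem sg_true : sg true = 1 := by simp [sg]
@[simp] theorem sg_false : sg false = -1 := by simp [sg]

/-- centred linear walk -/
def walk (a q : ℕ → ℝ) (n : ℕ) (b : ℕ → Bool) : ℝ :=
  ∑ i ∈ Finset.range n, a i * (sg (b i) - q i)

theorem dep_walk (a q : ℕ → ℝ) (n : ℕ) : Dep n (walk a q n) := by
  intro b b' hb
  apply Finset.sum_congr rfl
  intro i hi
  rw [hb i (Finset.mem_range.1 hi)]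

theorem walk_succ (a q : ℕ → ℝ) (n : ℕ) (b : ℕ → Bool) (x : Bool) :
    walk a q (n + 1) (Function.update b n x) = walk a q n b + a n * (sg x - q n) := by
  have := (dep_walk a q n).update le_rfl b x
  unfold walk at *
  rw [Finset.sum_range_succ, this, Function.update_self]

/-- the weights of signs with mean `q` -/
def wq (q : ℕ → ℝ) (i : ℕ) : ℝ := (1 + q i) / 2

variable {a q : ℕ → ℝ}

theorem Ex_walk (a q : ℕ → ℝ) (n : ℕ) : Ex (wq q) n (walk a q n) = 0 := by
  induction n with
  | zero => simp [Ex, walk]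
  | succ n ih =>
    simp only [Ex, walk_succ]
    rw [← ih]; congr 1; funext b; simp [wq]; ring

theorem Ex_walk_sq (a q : ℕ → ℝ) (n : ℕ) : Ex (wq q) n (fun b => walk a q n b ^ 2) =
    ∑ i ∈ Finset.range n, a i ^ 2 * (1 - q i ^ 2) := by
  induction n with
  | zero => simp [Ex, walk]
  | succ n ih =>
    simp only [Ex, walk_succ]
    rw [Finset.sum_range_succ, ← ih, ← Ex_const (wq q) n (a n ^ 2 * (1 - q n ^ 2)), ← Ex_add]
    congr 1; funext b; simp [wq]; ring

theorem Ex_walk_four (a q : ℕ → ℝ) (hq : ∀ i, q i ^ 2 ≤ 1) (B : ℝ) (hB : ∀ i, 4 * a i ^ 2 ≤ B)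
    (n : ℕ) : Ex (wq q) n (fun b => walk a q n b ^ 4) ≤
    3 * (∑ i ∈ Finset.range n, a i ^ 2 * (1 - q i ^ 2)) ^ 2 +
      B * ∑ i ∈ Finset.range n, a i ^ 2 * (1 - q i ^ 2) := by
  induction n with
  | zero => simp [Ex, walk]
  | succ n ih =>
    set V := ∑ i ∈ Finset.range n, a i ^ 2 * (1 - q i ^ 2) with hV
    have h : Ex (wq q) (n + 1) (fun b => walk a q (n + 1) b ^ 4) =
        Ex (wq q) n (fun b => walk a q n b ^ 4) + 6 * (a n ^ 2 * (1 - q n ^ 2)) * V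
         + (a n ^ 4 * (1 - q n ^ 2) * (1 + 3 * q n ^ 2)) := by
      have e0 := Ex_walk a q n
      have e2 := Ex_walk_sq a q n
      rw [← hV] at e2
      rw [← e2, ← Ex_mul_left, ← Ex_add,
        show (a n ^ 4 * (1 - q n ^ 2) * (1 + 3 * q n ^ 2)) =
          (-8 * a n ^ 3 * q n * (1 - q n ^ 2)) * Ex (wq q) n (walk a q n) +
            Ex (wq q) n (fun _ => (a n ^ 4 * (1 - q n ^ 2) * (1 + 3 * q n ^ 2))) by
          rw [e0, Ex_const]; ring, ← Ex_mul_left, ← Ex_add, ← Ex_add]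
      simp only [Ex, walk_succ]
      congr 1; funext b; simp [wq]; ring
    rw [h, Finset.sum_range_succ, ← hV]
    have h1 : a n ^ 4 * (1 - q n ^ 2) * (1 + 3 * q n ^ 2) ≤ B * (a n ^ 2 * (1 - q n ^ 2)) := by
      have : 0 ≤ a n ^ 2 * (1 - q n ^ 2) := mul_nonneg (sq_nonneg _) (by linarith [hq n])
      calc _ = (a n ^ 2 * (1 + 3 * q n ^ 2)) * (a n ^ 2 * (1 - q n ^ 2)) := by ring
        _ ≤ _ := by
          apply mul_le_mul_of_nonneg_right _ this
          nlinarith [hB n, hq n, sq_nonneg (a n), mul_nonneg (sq_nonneg (a n)) (sub_nonneg.2 (hq n))]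
    nlinarith [sq_nonneg (a n ^ 2 * (1 - q n ^ 2))]

theorem wq_nonneg (hq : ∀ i, q i ^ 2 ≤ 1) (i : ℕ) : 0 ≤ wq q i := by
  have := abs_le_one_iff_mul_self_le_one.2 (by nlinarith [hq i] : q i * q i ≤ 1)
  have := (abs_le.1 this).1
  unfold wq; linarith

theorem wq_le_one (hq : ∀ i, q i ^ 2 ≤ 1) (i : ℕ) : wq q i ≤ 1 := by
  have := abs_le_one_iff_mul_self_le_one.2 (by nlinarith [hq i] : q i * q i ≤ 1)
  have := (abs_le.1 this).2
  unfold wq; linarith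

/-- The negative part of the walk has mean of the order of the standard deviation. -/
theorem Ex_walk_neg (hq : ∀ i, q i ^ 2 ≤ 1) (B : ℝ) (hB0 : 0 ≤ B) (hB : ∀ i, 4 * a i ^ 2 ≤ B)
    (n : ℕ) (hV : 1 ≤ ∑ i ∈ Finset.range n, a i ^ 2 * (1 - q i ^ 2)) :
    3 / (8 * √(3 + B)) * √(∑ i ∈ Finset.range n, a i ^ 2 * (1 - q i ^ 2)) ≤
      Ex (wq q) n (fun b => max (-walk a q n b) 0) := by
  set V := ∑ i ∈ Finset.range n, a i ^ 2 * (1 - q i ^ 2) with hVd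
  set s := √((3 + B) * V) with hs
  have hs0 : 0 < s := Real.sqrt_pos.2 (by positivity)
  have hs2 : s ^ 2 = (3 + B) * V := Real.sq_sqrt (by positivity)
  have h4 : Ex (wq q) n (fun b => walk a q n b ^ 4) ≤ (3 + B) * V ^ 2 := by
    refine (Ex_walk_four a q hq B hB n).trans ?_
    rw [← hVd]; nlinarith [mul_le_mul_of_nonneg_left hV hB0, mul_nonneg hB0 (by linarith : 0 ≤ V)]
  have h2 := Ex_walk_sq a q n
  rw [← hVd] at h2
  have h0 := Ex_walk a q n
  -- pointwise inequality
  have hpt : ∀ x : ℝ, (1 / (2 * s)) * x ^ 2 + ((-1 / (8 * s ^ 3)) * x ^ 4 + (-1 / 2) * x)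
      ≤ max (-x) 0 := by
    intro x
    have h1 : max (-x) 0 = (|x| - x) / 2 := by
      rcases le_total 0 x with h | h
      · rw [abs_of_nonneg h, max_eq_right (by linarith)]; ring
      · rw [abs_of_nonpos h, max_eq_left (by linarith)]; ring
    rw [h1]
    have hx2 : x ^ 2 = |x| ^ 2 := (sq_abs x).symm
    have hx4 : x ^ 4 = |x| ^ 4 := by rw [show x ^ 4 = (x ^ 2) ^ 2 by ring, hx2]; ring
    rw [hx2, hx4]
    obtain ⟨y, hy⟩ : ∃ y, y = |x| / s := ⟨_, rfl⟩
    have hy0 : 0 ≤ y := by rw [hy]; positivity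
    have hxy : |x| = y * s := by rw [hy]; field_simp
    rw [hxy]
    have : 0 ≤ s * y * (1 - y + y ^ 3 / 4) := by
      apply mul_nonneg (by positivity)
      nlinarith [sq_nonneg (y - 1), mul_nonneg hy0 (sq_nonneg (y - 1))]
    have e : 1 / (2 * s) * (y * s) ^ 2 + (-1 / (8 * s ^ 3) * (y * s) ^ 4 + -1 / 2 * x) =
       (y * s - x) / 2 - (s * y * (1 - y + y ^ 3 / 4)) / 2 := by field_simp; ring
    rw [e]; linarith
  have := Ex_mono (wq_nonneg hq) (wq_le_one hq) n (fun b => hpt (walk a q n b))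
  refine le_trans ?_ this
  rw [Ex_add, Ex_add, Ex_mul_left, Ex_mul_left, Ex_mul_left, h2, h0]
  have h5 : (1 / (8 * s ^ 3)) * Ex (wq q) n (fun b => walk a q n b ^ 4) ≤
      (1 / (8 * s ^ 3)) * ((3 + B) * V ^ 2) := mul_le_mul_of_nonneg_left h4 (by positivity)
  have h6 : (1 / (8 * s ^ 3)) * ((3 + B) * V ^ 2) = V / (8 * s) := by
    rw [show (3 + B) * V ^ 2 = s ^ 2 * V by rw [hs2]; ring]; field_simp
  have h7 : 3 / (8 * √(3 + B)) * √V = 3 * V / (8 * s) := by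
    rw [hs, Real.sqrt_mul (by positivity)]
    have : √V * √V = V := Real.mul_self_sqrt (by positivity)
    have hVp : 0 < √V := Real.sqrt_pos.2 (by positivity)
    have hBp : 0 < √(3 + B) := Real.sqrt_pos.2 (by positivity)
    field_simp
    nlinarith
  rw [h7]
  have h8 : 1 / (2 * s) * V = 3 * V / (8 * s) + V / (8 * s) := by field_simp; ring
  rw [h8]
  have h9 : -1 / (8 * s ^ 3) * Ex (wq q) n (fun b => walk a q n b ^ 4) =
    - ((1 / (8 * s ^ 3)) * Ex (wq q) n (fun b => walk a q n b ^ 4)) := by ring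
  rw [h9]
  linarith

theorem exp_le_quad {u : ℝ} (hu : |u| ≤ 3) : Real.exp u ≤ 1 + u + 10 * u ^ 2 := by
  have h := abs_le.1 hu
  have hpos : 0 < 1 - u / 4 := by linarith
  have h1 : Real.exp (u / 4) ≤ 1 / (1 - u / 4) := by
    have := Real.add_one_le_exp (-(u / 4))
    rw [Real.exp_neg] at this
    have he := Real.exp_pos (u / 4)
    rw [le_div_iff₀ hpos]
    have := mul_le_mul_of_nonneg_left this he.le
    rw [mul_inv_cancel₀ he.ne'] at this
    linarith
  rcases le_total u 1 with hu1 | hu1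
  · by_cases hm : -1 ≤ u
    · have := Real.abs_exp_sub_one_sub_id_le (abs_le.2 ⟨hm, hu1⟩)
      have := (abs_le.1 this).2
      nlinarith [sq_nonneg u]
    · push Not at hm
      have : Real.exp u ≤ 1 := Real.exp_le_one_iff.2 (by linarith)
      nlinarith
  · -- 1 ≤ u ≤ 3
    have he : Real.exp u ≤ 1 + u + 10 * u ^ 2 := by
      have e1 : Real.exp 1 < 2.7182818286 := Real.exp_one_lt_d9
      rcases le_total u 2 with h2 | h2
      · have : Real.exp u ≤ Real.exp 2 := Real.exp_le_exp.2 h2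
        have e2 : Real.exp 2 = Real.exp 1 ^ 2 := by rw [← Real.exp_nat_mul]; norm_num
        have : Real.exp 1 ^ 2 ≤ 2.7182818286 ^ 2 := by gcongr
        nlinarith
      · have : Real.exp u ≤ Real.exp 3 := Real.exp_le_exp.2 h.2
        have e2 : Real.exp 3 = Real.exp 1 ^ 3 := by rw [← Real.exp_nat_mul]; norm_num
        have : Real.exp 1 ^ 3 ≤ 2.7182818286 ^ 3 := by gcongr
        nlinarith
    exact he

theorem Ex_walk_exp (hq : ∀ i, q i ^ 2 ≤ 1) (ha : ∀ i, |a i| ≤ 3 / 2) (n : ℕ) :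
    Ex (wq q) n (fun b => Real.exp (walk a q n b)) ≤
      Real.exp (10 * ∑ i ∈ Finset.range n, a i ^ 2) := by
  have h1 : ∀ b, Real.exp (walk a q n b) =
      ∏ i ∈ Finset.range n, (fun i x => Real.exp (a i * (sg x - q i))) i (b i) := by
    intro b; rw [walk, Real.exp_sum]
  have h2 := Ex_prod (wq q) n (fun i x => Real.exp (a i * (sg x - q i)))
  rw [show (fun b => Real.exp (walk a q n b)) = _ from funext h1, h2, Finset.mul_sum, Real.exp_sum]
  apply Finset.prod_le_prod
  · intro i _
    have := wq_nonneg hq i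
    have := wq_le_one hq i
    have : 0 ≤ 1 - wq q i := by linarith
    positivity
  · intro i _
    have h0 := wq_nonneg hq i
    have h1 := wq_le_one hq i
    have hq1 := abs_le_one_iff_mul_self_le_one.2 (by nlinarith [hq i] : q i * q i ≤ 1)
    have hb : ∀ x : Bool, |a i * (sg x - q i)| ≤ 3 := by
      intro x
      rw [abs_mul]
      have : |sg x - q i| ≤ 2 := by
        have := abs_le.1 hq1
        rw [abs_le]; cases x <;> simp <;> constructor <;> linarith
      calc _ ≤ (3 / 2) * 2 := mul_le_mul (ha i) this (abs_nonneg _) (by norm_num)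
        _ = 3 := by norm_num
    have e1 := mul_le_mul_of_nonneg_left (exp_le_quad (hb true)) h0
    have e2 := mul_le_mul_of_nonneg_left (exp_le_quad (hb false)) (sub_nonneg.2 h1)
    have e3 := Real.add_one_le_exp (10 * a i ^ 2)
    refine le_trans (add_le_add e1 e2) (le_trans ?_ e3)
    simp only [sg_true, sg_false, wq]
    have : 0 ≤ a i ^ 2 * q i ^ 2 := by positivity
    nlinarith


open Classical in
/-- survival indicator -/
def surv (L : ℕ → (ℕ → Bool) → ℝ) (Bd : ℕ → ℝ) (j : ℕ) (b : ℕ → Bool) : ℝ :=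
  if ∀ i < j, L i b ≤ Bd i then 1 else 0

section
variable {L : ℕ → (ℕ → Bool) → ℝ} {Bd : ℕ → ℝ}

theorem surv_nonneg (j : ℕ) (b : ℕ → Bool) : 0 ≤ surv L Bd j b := by
  unfold surv; split_ifs <;> norm_num

theorem surv_le_one (j : ℕ) (b : ℕ → Bool) : surv L Bd j b ≤ 1 := by
  unfold surv; split_ifs <;> norm_num

theorem surv_zero (b : ℕ → Bool) : surv L Bd 0 b = 1 := by
  unfold surv; simp

theorem surv_anti (j : ℕ) (b : ℕ → Bool) : surv L Bd (j + 1) b ≤ surv L Bd j b := by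
  unfold surv
  split_ifs with h1 h2
  · exact le_rfl
  · exact absurd (fun i hi => h1 i (by omega)) h2
  · norm_num
  · exact le_rfl

theorem surv_mul_le (j : ℕ) (b : ℕ → Bool) {x y z : ℝ} (hz : 0 ≤ z) (hz1 : z ≤ surv L Bd j b)
    (h : (∀ i < j, L i b ≤ Bd i) → x ≤ y) : x * z ≤ y * z := by
  by_cases hs : ∀ i < j, L i b ≤ Bd i
  · exact mul_le_mul_of_nonneg_right (h hs) hz
  · have : z = 0 := by
      rw [surv, if_neg hs] at hz1
      exact le_antisymm hz1 hz
    simp [this]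

theorem surv_dep {nn : ℕ → ℕ} (hnn : Monotone nn) (hL : ∀ j, Dep (nn j) (L j)) (j : ℕ) :
    Dep (nn j) (surv L Bd (j + 1)) := by
  intro b b' hb
  unfold surv
  have : (∀ i < j + 1, L i b ≤ Bd i) ↔ (∀ i < j + 1, L i b' ≤ Bd i) := by
    refine forall₂_congr fun i hi => ?_
    rw [hL i b b' fun k hk => hb k (hk.trans_le (hnn (by omega)))]
  simp only [this]

theorem surv_decr {o : ℕ → Bool}
    (hL : ∀ j b i, L j (Function.update b i (!o i)) ≤ L j (Function.update b i (o i))) (j : ℕ) :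
    Decr o (surv L Bd j) := by
  intro b i
  unfold surv
  split_ifs with h1 h2
  · exact le_rfl
  · exact absurd (fun k hk => (hL k b i).trans (h1 k hk)) h2
  · norm_num
  · exact le_rfl
end

theorem sum_inv_sq_le (K : ℕ) :
    ∑ j ∈ Finset.range (K + 1), 1 / ((j : ℝ) + 1) ^ 2 ≤ 2 - 1 / ((K : ℝ) + 1) := by
  induction K with
  | zero => norm_num [Finset.sum_range_succ]
  | succ K ihK =>
    rw [Finset.sum_range_succ]
    push_cast
    have : 1 / ((K : ℝ) + 1 + 1) ^ 2 ≤ 1 / ((K : ℝ) + 1) - 1 / ((K : ℝ) + 1 + 1) := by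
      rw [div_sub_div _ _ (by positivity) (by positivity), div_le_div_iff₀ (by positivity)
        (by positivity)]
      ring_nf; nlinarith [(Nat.cast_nonneg K : (0:ℝ) ≤ K)]
    linarith

theorem ballot_step (a q : ℕ → ℝ) (hq : ∀ i, q i ^ 2 ≤ 1) (o : ℕ → Bool)
    (ho : ∀ i, 0 ≤ a i * sg (o i)) (nn : ℕ → ℕ) (hnn : Monotone nn)
    (L : ℕ → (ℕ → Bool) → ℝ) (Bd : ℕ → ℝ) (hL : ∀ j, Dep (nn j) (L j))
    (hLo : ∀ j b i, L j (Function.update b i (!o i)) ≤ L j (Function.update b i (o i)))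
    (R : ℕ → (ℕ → Bool) → ℝ) (D β : ℝ) (hβ : 0 ≤ β) (N J : ℕ) (hN : nn J ≤ N)
    (hR : ∀ j ≤ J, Ex (wq q) N (fun b => Real.exp (R j b)) ≤ D)
    (hdom : ∀ j ≤ J, ∀ b, (∀ i < j, L i b ≤ Bd i) → walk a q (nn j) b ≤ β + R j b) :
    Ex (wq q) N (surv L Bd J) * Ex (wq q) (nn J) (fun b => max (-walk a q (nn J) b) 0) ≤
      β + 2 * D + ∑ j ∈ Finset.range J, 2 / ((j : ℝ) + 1) * Ex (wq q) N (surv L Bd (j + 1)) := by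
  have w0 := wq_nonneg hq
  have w1 := wq_le_one hq
  set E : ((ℕ → Bool) → ℝ) → ℝ := Ex (wq q) N with hE
  set M : ℕ → (ℕ → Bool) → ℝ := fun j => walk a q (nn j) with hM
  set s := surv L Bd with hs
  have hD : 0 ≤ D := (Ex_nonneg w0 w1 N (fun b => (Real.exp_pos _).le)).trans (hR 0 (Nat.zero_le _))
  -- orthogonality
  have horth : ∀ j < J, E (fun b => (M (j + 1) b - M j b) * s (j + 1) b) = 0 := by
    intro j hj
    have e : (fun b => (M (j + 1) b - M j b) * s (j + 1) b) = fun b =>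
        ∑ i ∈ Finset.Ico (nn j) (nn (j + 1)), (fun x => a i * (sg x - q i)) (b i) * s (j + 1) b := by
      funext b
      rw [← Finset.sum_mul, Finset.sum_Ico_eq_sub _ (hnn (Nat.le_succ j))]
      rfl
    rw [e, hE, Ex_sum]
    apply Finset.sum_eq_zero
    intro i hi
    rw [Finset.mem_Ico] at hi
    rw [Ex_mul_coord (wq q) (lt_of_lt_of_le hi.2 ((hnn (by omega)).trans hN))
      ((surv_dep (Bd := Bd) hnn hL j).mono hi.1) (fun x => a i * (sg x - q i))]
    simp [wq]; left; ring
  have hM0 : E (M 0) = 0 := by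
    rw [hE, Ex_stable (wq q) ((hnn (Nat.zero_le J)).trans hN) (dep_walk a q (nn 0))]
    exact Ex_walk a q _
  have hid : ∀ K ≤ J, E (fun b => M K b * s K b) +
      ∑ j ∈ Finset.range K, E (fun b => M j b * (s j b - s (j + 1) b)) = 0 := by
    intro K
    induction K with
    | zero => intro _; simp [hs, surv_zero, hM0]
    | succ K ih =>
      intro hK
      rw [Finset.sum_range_succ]
      have h1 := ih (by omega)
      have h2 := horth K (by omega)
      have h3 : E (fun b => M (K + 1) b * s (K + 1) b) + E (fun b => M K b * (s K b - s (K + 1) b))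
          = E (fun b => M K b * s K b) + E (fun b => (M (K + 1) b - M K b) * s (K + 1) b) := by
        rw [hE, ← Ex_add, ← Ex_add]; congr 1; funext b; ring
      linarith
  -- Harris
  have hhar : E (s J) * Ex (wq q) (nn J) (fun b => max (-M J b) 0) ≤
      E (fun b => s J b * max (-M J b) 0) := by
    rw [← Ex_stable (wq q) hN ((dep_walk a q (nn J)).comp (fun x => max (-x) 0))]
    apply Harris w0 w1 o N (surv_decr hLo J)
    intro b i
    apply max_le_max_right
    have : M J (Function.update b i (!o i)) ≤ M J (Function.update b i (o i)) := by
      apply Finset.sum_le_sum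
      intro k _
      by_cases hk : k = i
      · subst hk
        simp only [Function.update_self]
        have := ho k
        cases h : o k <;> simp [h] at this ⊢ <;> linarith
      · simp [Function.update_of_ne hk]
    linarith
  refine hhar.trans ?_
  -- decomposition
  have hdec : E (fun b => s J b * max (-M J b) 0) =
      E (fun b => max (M J b) 0 * s J b) +
        ∑ j ∈ Finset.range J, E (fun b => M j b * (s j b - s (j + 1) b)) := by
    have h1 : E (fun b => s J b * max (-M J b) 0) =
        E (fun b => max (M J b) 0 * s J b) - E (fun b => M J b * s J b) := by
      rw [hE, ← Ex_sub]; congr 1; funext b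
      rcases le_total 0 (M J b) with h | h
      · rw [max_eq_left h, max_eq_right (by linarith)]; ring
      · rw [max_eq_right h, max_eq_left (by linarith)]; ring
    rw [h1]; linarith [hid J le_rfl]
  rw [hdec]
  set h : ℕ → ℝ := fun j => 2 * Real.log (j + 1) with hh
  have hh0 : ∀ j, 0 ≤ h j := fun j => by
    have : 0 ≤ Real.log ((j : ℝ) + 1) := Real.log_nonneg (by linarith [(Nat.cast_nonneg j : (0:ℝ) ≤ j)])
    simp only [hh]; linarith
  have hRle : ∀ j b, R j b ≤ h j + 1 / ((j : ℝ) + 1) ^ 2 * Real.exp (R j b) := by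
    intro j b
    have h1 := Real.add_one_le_exp (R j b - h j)
    have h2 : Real.exp (R j b - h j) = 1 / ((j : ℝ) + 1) ^ 2 * Real.exp (R j b) := by
      rw [Real.exp_sub, hh]
      simp only
      rw [two_mul, Real.exp_add, Real.exp_log (by positivity)]
      field_simp
    linarith
  have hterm : ∀ j ≤ J, ∀ z : (ℕ → Bool) → ℝ, (∀ b, 0 ≤ z b) → (∀ b, z b ≤ s j b) → 
      ∀ m : (ℕ → Bool) → ℝ, (∀ b, m b ≤ max (M j b) 0) →
      E (fun b => m b * z b) ≤ (β + h j) * E z + 1 / ((j : ℝ) + 1) ^ 2 * D := by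
    intro j hj z hz0 hzs m hm
    have h1 : E (fun b => m b * z b) ≤
        E (fun b => (β + h j) * z b + 1 / ((j : ℝ) + 1) ^ 2 * Real.exp (R j b)) := by
      apply Ex_mono w0 w1
      intro b
      have h2 : m b * z b ≤ (β + h j + 1 / ((j : ℝ) + 1) ^ 2 * Real.exp (R j b)) * z b := by
        apply surv_mul_le j b (hz0 b) (hzs b)
        intro hsv
        refine (hm b).trans (max_le ?_ ?_)
        · have := hdom j hj b hsv
          have := hRle j b
          simp only [hM]
          linarith
        · have := hh0 j
          positivity
      have h3 : 1 / ((j : ℝ) + 1) ^ 2 * Real.exp (R j b) * z b ≤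
          1 / ((j : ℝ) + 1) ^ 2 * Real.exp (R j b) * 1 :=
        mul_le_mul_of_nonneg_left ((hzs b).trans (surv_le_one j b)) (by positivity)
      linarith
    refine h1.trans ?_
    rw [hE, Ex_add, Ex_mul_left, Ex_mul_left]
    gcongr
    exact hR j hj
  have hJ := hterm J le_rfl (s J) (surv_nonneg J) (fun b => le_rfl) (fun b => max (M J b) 0)
    (fun b => le_rfl)
  have hj : ∀ j ∈ Finset.range J, E (fun b => M j b * (s j b - s (j + 1) b)) ≤
      (β + h j) * (E (s j) - E (s (j + 1))) + 1 / ((j : ℝ) + 1) ^ 2 * D := by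
    intro j hj
    have := hterm j (Finset.mem_range.1 hj).le (fun b => s j b - s (j + 1) b)
      (fun b => sub_nonneg.2 (surv_anti j b)) (fun b => by linarith [surv_nonneg (L := L) (Bd := Bd) (j + 1) b])
      (M j) (fun b => le_max_left _ _)
    rw [show E (fun b => s j b - s (j + 1) b) = E (s j) - E (s (j + 1)) from Ex_sub _ _ _ _] at this
    exact this
  have hsum := Finset.sum_le_sum hj
  have habel : ∀ K, (β + h K) * E (s K) +
      ∑ j ∈ Finset.range K, (β + h j) * (E (s j) - E (s (j + 1))) ≤
      β + ∑ j ∈ Finset.range K, 2 / ((j : ℝ) + 1) * E (s (j + 1)) := by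
    intro K
    induction K with
    | zero =>
      have : E (s 0) = 1 := by
        rw [hE, hs, show surv L Bd 0 = fun _ => 1 from funext surv_zero]
        exact Ex_const _ _ _
      simp [this, hh]
    | succ K ih =>
      rw [Finset.sum_range_succ, Finset.sum_range_succ]
      have h1 : (h (K + 1) - h K) * E (s (K + 1)) ≤ 2 / ((K : ℝ) + 1) * E (s (K + 1)) := by
        apply mul_le_mul_of_nonneg_right _ (Ex_nonneg w0 w1 N (surv_nonneg _))
        simp only [hh]
        push_cast
        rw [← mul_sub, ← Real.log_div (by positivity) (by positivity)]
        have := Real.log_le_sub_one_of_pos (show 0 < ((K : ℝ) + 1 + 1) / (K + 1) by positivity)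
        have e : ((K : ℝ) + 1 + 1) / (K + 1) - 1 = 1 / (K + 1) := by field_simp; ring
        rw [e] at this
        calc _ ≤ 2 * (1 / ((K : ℝ) + 1)) := by linarith
          _ = _ := by ring
      linarith
  have h3 := habel J
  have h4 := sum_inv_sq_le J
  rw [Finset.sum_range_succ] at h4
  have h5 : (∑ j ∈ Finset.range J, 1 / ((j : ℝ) + 1) ^ 2 + 1 / ((J : ℝ) + 1) ^ 2) * D ≤ 2 * D := by
    apply mul_le_mul_of_nonneg_right _ hD
    have : 0 ≤ 1 / ((J : ℝ) + 1) := by positivity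
    linarith
  rw [Finset.sum_add_distrib, ← Finset.sum_mul] at hsum
  linarith

/-- The bootstrap. -/
theorem bootstrap (c : ℝ) (hc : 0 < c) : ∃ C : ℝ, 0 < C ∧ ∀ (u : ℕ → ℝ) (β : ℝ) (K : ℕ), 1 ≤ β →
    (∀ j, 0 ≤ u j) → (∀ j, u j ≤ 1) →
    (∀ J, 1 ≤ J → J ≤ K → c * √J * u J ≤ β + ∑ j ∈ Finset.range J, 2 / ((j : ℝ) + 1) * u (j + 1)) →
    ∀ J, 1 ≤ J → J ≤ K → u J ≤ C * β / √J := by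
  have hsm : Summable (fun j : ℕ => ((j : ℝ) + 1) ^ (-(5 / 4 : ℝ))) := by
    have := (Real.summable_nat_rpow (p := -(5 / 4 : ℝ))).2 (by norm_num)
    have := (summable_nat_add_iff 1).2 this
    simpa using this
  set S := ∑' j : ℕ, ((j : ℝ) + 1) ^ (-(5 / 4 : ℝ)) with hS
  have hS0 : 0 ≤ S := tsum_nonneg fun j => by positivity
  refine ⟨(1 + 22 / c * S) / c, by positivity, ?_⟩
  intro u β K hβ hu0 hu1 hrec
  have hfirst : ∀ J, 1 ≤ J → J ≤ K → u J ≤ 11 * β / c * (J : ℝ) ^ (-(1 / 4 : ℝ)) := by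
    intro J hJ hJK
    have hJ' : (1 : ℝ) ≤ J := by exact_mod_cast hJ
    have h1 := hrec J hJ hJK
    have h2 : ∑ j ∈ Finset.range J, 2 / ((j : ℝ) + 1) * u (j + 1) ≤ 2 * (1 + Real.log J) := by
      have := harmonic_le_one_add_log J
      refine le_trans ?_ (mul_le_mul_of_nonneg_left this (by norm_num))
      rw [harmonic]; push_cast; rw [Finset.mul_sum]
      apply Finset.sum_le_sum
      intro j _
      calc 2 / ((j : ℝ) + 1) * u (j + 1) ≤ 2 / ((j : ℝ) + 1) * 1 :=
            mul_le_mul_of_nonneg_left (hu1 _) (by positivity)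
        _ = _ := by ring
    have h3 : Real.log J ≤ (J : ℝ) ^ (1 / 4 : ℝ) / (1 / 4) := Real.log_le_rpow_div (by positivity) (by norm_num)
    have h4 : 1 ≤ (J : ℝ) ^ (1 / 4 : ℝ) := Real.one_le_rpow hJ' (by norm_num)
    set x := (J : ℝ) ^ (1 / 4 : ℝ) with hx
    have hx2 : √(J : ℝ) = x * x := by
      rw [hx, ← Real.rpow_add (by positivity), Real.sqrt_eq_rpow]; norm_num
    have hxi : (J : ℝ) ^ (-(1 / 4 : ℝ)) = x⁻¹ := by rw [Real.rpow_neg (by positivity)]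
    rw [hxi]
    have hx0 : 0 < x := by linarith
    have h5 : c * (x * x) * u J ≤ 11 * β * x := by
      rw [← hx2]
      nlinarith
    rw [show 11 * β / c * x⁻¹ = 11 * β / (c * x) by field_simp, le_div_iff₀ (by positivity)]
    have : x * (u J * (c * x)) ≤ x * (11 * β) := by linarith
    exact le_of_mul_le_mul_left this hx0
  intro J hJ hJK
  have hJ' : (1 : ℝ) ≤ J := by exact_mod_cast hJ
  have h1 := hrec J hJ hJK
  have h2 : ∑ j ∈ Finset.range J, 2 / ((j : ℝ) + 1) * u (j + 1) ≤ 22 * β / c * S := by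
    calc _ ≤ ∑ j ∈ Finset.range J, 22 * β / c * ((j : ℝ) + 1) ^ (-(5 / 4 : ℝ)) := by
          apply Finset.sum_le_sum
          intro j hj
          have := hfirst (j + 1) (by omega) (by rw [Finset.mem_range] at hj; omega)
          push_cast at this
          refine (mul_le_mul_of_nonneg_left this (by positivity)).trans (le_of_eq ?_)
          rw [show (-(5 / 4 : ℝ)) = -1 + -(1 / 4) by norm_num, Real.rpow_add (by positivity),
            Real.rpow_neg_one]
          field_simp; norm_num
      _ ≤ _ := by
          rw [← Finset.mul_sum]
          exact mul_le_mul_of_nonneg_left (hsm.sum_le_tsum _ fun _ _ => by positivity) (by positivity)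
  have hs : 0 < √(J : ℝ) := Real.sqrt_pos.2 (by linarith)
  rw [le_div_iff₀ hs]
  have h3 : c * √J * u J ≤ (1 + 22 / c * S) * β := by
    have : (1 + 22 / c * S) * β = β + 22 * β / c * S := by ring
    linarith
  rw [div_mul_eq_mul_div, le_div_iff₀ hc]
  linarith


def fracInt (s : ℂ) : ℂ := ∫ t in Set.Ioi (1 : ℝ), ((Int.fract t : ℝ) : ℂ) * (t : ℂ) ^ (-(s + 1))

lemma norm_cpow_frac {t : ℝ} (ht : 1 < t) (s : ℂ) :
    ‖(t : ℂ) ^ (-(s + 1))‖ = t ^ (-(s.re + 1)) := by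
  rw [Complex.norm_cpow_eq_rpow_re_of_pos (by linarith)]
  simp

lemma integrableOn_cpow_frac {s : ℂ} (hs : 0 < s.re) :
    IntegrableOn (fun t : ℝ => (t : ℂ) ^ (-(s + 1))) (Set.Ioi 1) :=
  integrableOn_Ioi_cpow_of_lt (by simp; linarith) one_pos

lemma integrableOn_fract {s : ℂ} (hs : 0 < s.re) :
    IntegrableOn (fun t : ℝ => ((Int.fract t : ℝ) : ℂ) * (t : ℂ) ^ (-(s + 1))) (Set.Ioi 1) := by
  refine (integrableOn_cpow_frac hs).bdd_mul (c := 1) ?_ ?_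
  · exact (Complex.measurable_ofReal.comp measurable_fract).aestronglyMeasurable
  · refine Filter.Eventually.of_forall fun t => ?_
    rw [Complex.norm_real, Real.norm_eq_abs, abs_of_nonneg (Int.fract_nonneg t)]
    exact (Int.fract_lt_one t).le

lemma zeta_repr {s : ℂ} (hs : 1 < s.re) :
    riemannZeta s = s / (s - 1) - s * fracInt s := by
  have h1 : LSeries (fun _ => (1 : ℂ)) s = riemannZeta s := by
    have := LSeries_one_eq_riemannZeta hs
    simpa [Pi.one_def] using this
  have h2 := LSeries_eq_mul_integral' (fun _ => (1 : ℂ)) (r := 1) zero_le_one hs (by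
    simp only [norm_one, Finset.sum_const, Nat.card_Icc, nsmul_eq_mul, mul_one, Real.rpow_one]
    simp
    exact Asymptotics.isBigO_refl _ _)
  rw [← h1, h2]
  have hs1 : s - 1 ≠ 0 := by
    intro h
    have := congrArg Complex.re h
    simp at this
    linarith
  have h3 : ∀ t ∈ Set.Ioi (1 : ℝ), (∑ k ∈ Finset.Icc 1 ⌊t⌋₊, (1 : ℂ)) * (t : ℂ) ^ (-(s + 1))
      = (t : ℂ) ^ (-s) - ((Int.fract t : ℝ) : ℂ) * (t : ℂ) ^ (-(s + 1)) := by
    intro t ht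
    have ht0 : (0:ℝ) < t := lt_trans one_pos ht
    have hfl : ((⌊t⌋₊ : ℕ) : ℂ) = (t : ℂ) - ((Int.fract t : ℝ) : ℂ) := by
      rw [← Complex.ofReal_sub, Int.self_sub_fract, ← natCast_floor_eq_intCast_floor ht0.le]
      simp
    have hp : (t : ℂ) ^ (-s) = (t : ℂ) * (t : ℂ) ^ (-(s + 1)) := by
      rw [show -s = 1 + (-(s+1)) by ring, Complex.cpow_add _ _ (by exact_mod_cast ht0.ne'),
        Complex.cpow_one]
    rw [hp]
    simp only [Finset.sum_const, Nat.card_Icc, nsmul_eq_mul, mul_one, Nat.add_sub_cancel, hfl]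
    ring
  rw [setIntegral_congr_fun measurableSet_Ioi h3, integral_sub, integral_Ioi_cpow_of_lt]
  · simp only [Complex.ofReal_one, Complex.one_cpow, fracInt]
    have : -s + 1 ≠ 0 := by
      intro h; apply hs1; linear_combination -h
    field_simp
    ring
  · simp; linarith
  · exact one_pos
  · exact integrableOn_Ioi_cpow_of_lt (by simp; linarith) one_pos
  · exact integrableOn_fract (by linarith)

lemma norm_fracInt_le {s : ℂ} (hs : 0 < s.re) : ‖fracInt s‖ ≤ 1 / s.re := by
  have h : ∫ t in Set.Ioi (1 : ℝ), t ^ (-(s.re + 1)) = 1 / s.re := by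
    rw [integral_Ioi_rpow_of_lt (by linarith) one_pos]
    simp
  rw [← h]
  refine norm_integral_le_of_norm_le (integrableOn_Ioi_rpow_of_lt (by linarith) one_pos) ?_
  refine (ae_restrict_iff' measurableSet_Ioi).2 (Filter.Eventually.of_forall fun t ht => ?_)
  rw [norm_mul, norm_cpow_frac ht, Complex.norm_real, Real.norm_eq_abs,
    abs_of_nonneg (Int.fract_nonneg t)]
  have : 0 ≤ t ^ (-(s.re + 1)) := Real.rpow_nonneg (by linarith [Set.mem_Ioi.1 ht]) _
  nlinarith [Int.fract_lt_one t]

lemma fracInt_lip {s : ℂ} {h : ℝ} (hs : 1 ≤ s.re) (hh : 0 ≤ h) :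
    ‖fracInt s - fracInt (s + h)‖ ≤ 4 * h := by
  have e1 : fracInt s - fracInt (s + h) = ∫ t in Set.Ioi (1 : ℝ),
      (((Int.fract t : ℝ) : ℂ) * (t : ℂ) ^ (-(s + 1)) -
        ((Int.fract t : ℝ) : ℂ) * (t : ℂ) ^ (-((s + h) + 1))) := by
    rw [integral_sub (integrableOn_fract (by linarith)) (integrableOn_fract (by simp; linarith))]
    rfl
  have h2 : ∫ t in Set.Ioi (1 : ℝ), 2 * h * t ^ (-(3/2:ℝ)) = 4 * h := by
    rw [integral_const_mul, integral_Ioi_rpow_of_lt (by norm_num) one_pos]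
    norm_num
    ring
  rw [e1, ← h2]
  refine norm_integral_le_of_norm_le
    ((integrableOn_Ioi_rpow_of_lt (by norm_num) one_pos).const_mul _) ?_
  refine (ae_restrict_iff' measurableSet_Ioi).2 (Filter.Eventually.of_forall fun t ht => ?_)
  have ht1 : (1:ℝ) < t := ht
  have ht0 : (0:ℝ) < t := by linarith
  have e3 : ((Int.fract t : ℝ) : ℂ) * (t : ℂ) ^ (-(s + 1)) -
        ((Int.fract t : ℝ) : ℂ) * (t : ℂ) ^ (-((s + h) + 1))
      = ((Int.fract t : ℝ) : ℂ) * ((t : ℂ) ^ (-(s + 1)) * ((1 - t ^ (-h) : ℝ) : ℂ)) := by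
    rw [show -((s + h) + 1) = -(s+1) + (-h : ℂ) by ring,
      Complex.cpow_add _ _ (by exact_mod_cast ht0.ne')]
    push_cast
    rw [Complex.ofReal_cpow ht0.le]
    push_cast
    ring
  rw [e3, norm_mul, norm_mul, norm_cpow_frac ht, Complex.norm_real, Complex.norm_real,
    Real.norm_eq_abs, Real.norm_eq_abs, abs_of_nonneg (Int.fract_nonneg t)]
  have hx : 0 ≤ 1 - t ^ (-h) := by
    have := Real.rpow_le_one_of_one_le_of_nonpos ht1.le (by linarith : -h ≤ 0)
    linarith
  rw [abs_of_nonneg hx]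
  have hlog : Real.log t ≤ 2 * t ^ (1/2:ℝ) := by
    have := Real.log_le_rpow_div ht0.le (by norm_num : (0:ℝ) < 1/2)
    linarith
  have hx2 : 1 - t ^ (-h) ≤ h * Real.log t := by
    rw [Real.rpow_def_of_pos ht0]
    have := Real.add_one_le_exp (Real.log t * -h)
    linarith
  have hx3 : 1 - t ^ (-h) ≤ 2 * h * t ^ (1/2:ℝ) := by nlinarith
  have hp : t ^ (-(s.re + 1)) ≤ t ^ (-2:ℝ) :=
    Real.rpow_le_rpow_of_exponent_le ht1.le (by linarith)
  have hp0 : 0 ≤ t ^ (-(s.re + 1)) := Real.rpow_nonneg ht0.le _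
  have e4 : t ^ (-(3/2:ℝ)) = t ^ (-2:ℝ) * t ^ (1/2:ℝ) := by
    rw [← Real.rpow_add ht0]; norm_num
  calc Int.fract t * (t ^ (-(s.re + 1)) * (1 - t ^ (-h)))
      ≤ 1 * (t ^ (-2:ℝ) * (2 * h * t ^ (1/2:ℝ))) := by
        gcongr
        exact (Int.fract_lt_one t).le
    _ = 2 * h * t ^ (-(3/2:ℝ)) := by rw [e4]; ring

lemma zeta_upper {s : ℂ} (hs : 1 < s.re) : ‖riemannZeta s‖ ≤ ‖s‖ * (1 / ‖s - 1‖ + 1) := by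
  rw [zeta_repr hs]
  have h1 : ‖fracInt s‖ ≤ 1 := (norm_fracInt_le (by linarith)).trans
    (by rw [div_le_one (by linarith)]; exact hs.le)
  calc ‖s / (s - 1) - s * fracInt s‖ ≤ ‖s / (s - 1)‖ + ‖s * fracInt s‖ := norm_sub_le _ _
    _ = ‖s‖ * (1 / ‖s - 1‖) + ‖s‖ * ‖fracInt s‖ := by rw [norm_div, norm_mul]; ring
    _ ≤ _ := by rw [mul_add]; gcongr

lemma zeta_lower_near {s : ℂ} (hs : 1 < s.re) :
    ‖s‖ * (1 / ‖s - 1‖ - 1) ≤ ‖riemannZeta s‖ := by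
  rw [zeta_repr hs]
  have h1 : ‖fracInt s‖ ≤ 1 := (norm_fracInt_le (by linarith)).trans
    (by rw [div_le_one (by linarith)]; exact hs.le)
  calc ‖s‖ * (1 / ‖s - 1‖ - 1) ≤ ‖s‖ * (1 / ‖s - 1‖ - ‖fracInt s‖) := by gcongr
    _ = ‖s / (s - 1)‖ - ‖s * fracInt s‖ := by rw [norm_div, norm_mul]; ring
    _ ≤ _ := norm_sub_norm_le _ _

lemma zeta_real_upper {d : ℝ} (hd : 0 < d) : ‖riemannZeta (1 + d)‖ ≤ 1 / d + 2 := by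
  have hs : 1 < (1 + (d:ℂ)).re := by simp [hd]
  rw [zeta_repr hs]
  have hn : ‖(1 + (d:ℂ))‖ = 1 + d := by
    rw [← Complex.ofReal_one, ← Complex.ofReal_add, Complex.norm_real, Real.norm_eq_abs,
      abs_of_nonneg (by linarith)]
  have h1 : ‖(1 + (d:ℂ)) * fracInt (1 + d)‖ ≤ 1 := by
    rw [norm_mul, hn]
    have := norm_fracInt_le (s := 1 + d) (by linarith)
    calc (1 + d) * ‖fracInt (1 + d)‖ ≤ (1 + d) * (1 / (1 + (d:ℂ)).re) := by gcongr
      _ = 1 := by simp; field_simp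
  have h2 : ‖(1 + (d:ℂ)) / (1 + d - 1)‖ = 1 / d + 1 := by
    rw [norm_div, hn, add_sub_cancel_left, Complex.norm_real, Real.norm_eq_abs, abs_of_pos hd]
    field_simp
  calc _ ≤ _ := norm_sub_le _ _
    _ ≤ (1 / d + 1) + 1 := by rw [h2]; gcongr
    _ = _ := by ring

lemma zeta_real_lower {d : ℝ} (hd : 0 < d) : 1 / d ≤ ‖riemannZeta (1 + d)‖ := by
  have hs : 1 < (1 + (d:ℂ)).re := by simp [hd]
  rw [zeta_repr hs]
  have hn : ‖(1 + (d:ℂ))‖ = 1 + d := by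
    rw [← Complex.ofReal_one, ← Complex.ofReal_add, Complex.norm_real, Real.norm_eq_abs,
      abs_of_nonneg (by linarith)]
  have h1 : ‖(1 + (d:ℂ)) * fracInt (1 + d)‖ ≤ 1 := by
    rw [norm_mul, hn]
    have := norm_fracInt_le (s := 1 + d) (by linarith)
    calc (1 + d) * ‖fracInt (1 + d)‖ ≤ (1 + d) * (1 / (1 + (d:ℂ)).re) := by gcongr
      _ = 1 := by simp; field_simp
  have h2 : ‖(1 + (d:ℂ)) / (1 + d - 1)‖ = 1 / d + 1 := by
    rw [norm_div, hn, add_sub_cancel_left, Complex.norm_real, Real.norm_eq_abs, abs_of_pos hd]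
    field_simp
  calc 1 / d = (1/d + 1) - 1 := by ring
    _ ≤ ‖(1 + (d:ℂ)) / (1 + d - 1)‖ - ‖(1 + (d:ℂ)) * fracInt (1 + d)‖ := by rw [h2]; gcongr
    _ ≤ _ := norm_sub_norm_le _ _


lemma zeta_341 {x : ℝ} (hx : 0 < x) (y : ℝ) :
    1 ≤ ‖riemannZeta (1 + x)‖ ^ 3 * ‖riemannZeta (1 + x + y * Complex.I)‖ ^ 4 *
      ‖riemannZeta (1 + x + (2 * y : ℝ) * Complex.I)‖ := by
  have h := DirichletCharacter.norm_LFunction_product_ge_one (N := 1) (1 : DirichletCharacter ℂ 1)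
    hx y
  simp only [DirichletCharacter.LFunctionTrivChar, one_pow] at h
  simp only [DirichletCharacter.LFunction_modOne_eq] at h
  rw [norm_mul, norm_mul, norm_pow, norm_pow] at h
  convert h using 4
  · ring_nf
  · push_cast; ring_nf

lemma norm_sub_one_ge {d u : ℝ} (h : 1/4 ≤ d ∨ 1/4 ≤ |u|) :
    1/4 ≤ ‖(1 + d + u * Complex.I : ℂ) - 1‖ := by
  have e : (1 + d + u * Complex.I : ℂ) - 1 = d + u * Complex.I := by ring
  rw [e]
  rcases h with h | h
  · have := Complex.abs_re_le_norm (d + u * Complex.I : ℂ)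
    simp at this
    linarith [le_abs_self d]
  · have := Complex.abs_im_le_norm (d + u * Complex.I : ℂ)
    simp at this
    linarith

lemma norm_s_le {d u : ℝ} (hd : 0 < d) (hd1 : d ≤ 1) :
    ‖(1 + d + u * Complex.I : ℂ)‖ ≤ 2 + |u| := by
  calc ‖(1 + d + u * Complex.I : ℂ)‖ ≤ ‖((1 + d : ℝ) : ℂ)‖ + ‖(u * Complex.I : ℂ)‖ := by
        push_cast; exact norm_add_le _ _
    _ = (1 + d) + |u| := by
        rw [Complex.norm_real, Real.norm_eq_abs, abs_of_nonneg (by linarith)]; simp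
    _ ≤ _ := by linarith

lemma zeta_lower_341 {d u : ℝ} (hd : 0 < d) (hd1 : d ≤ 1) (h : 1/4 ≤ d ∨ 1/4 ≤ |u|) :
    d ^ 3 ≤ 270 * (2 + |u|) * ‖riemannZeta (1 + d + u * Complex.I)‖ ^ 4 := by
  have h1 := zeta_341 hd u
  have h2 : ‖riemannZeta (1 + d)‖ ≤ 3 / d := (zeta_real_upper hd).trans (by
    rw [le_div_iff₀ hd, add_mul]; field_simp; linarith)
  have h3 : ‖riemannZeta (1 + d + (2 * u : ℝ) * Complex.I)‖ ≤ 10 * (2 + |u|) := by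
    have hs : 1 < (1 + d + (2 * u : ℝ) * Complex.I : ℂ).re := by simp [hd]
    refine (zeta_upper hs).trans ?_
    have h4 : 1/4 ≤ ‖(1 + d + (2 * u : ℝ) * Complex.I : ℂ) - 1‖ := by
      apply norm_sub_one_ge
      rcases h with h | h
      · exact Or.inl h
      · right; rw [abs_mul]; simp; linarith
    have h5 := norm_s_le (u := 2 * u) hd hd1
    have h6 : 1 / ‖(1 + d + (2 * u : ℝ) * Complex.I : ℂ) - 1‖ ≤ 4 := by
      rw [div_le_iff₀ (by linarith)]; linarith
    calc _ ≤ (2 + |2 * u|) * (4 + 1) := by gcongr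
      _ ≤ _ := by rw [abs_mul]; simp; linarith [abs_nonneg u]
  have h7 : 1 ≤ (3 / d) ^ 3 * ‖riemannZeta (1 + d + u * Complex.I)‖ ^ 4 * (10 * (2 + |u|)) := by
    refine h1.trans ?_
    gcongr
  rw [div_pow, div_mul_eq_mul_div, div_mul_eq_mul_div, le_div_iff₀ (by positivity)] at h7
  nlinarith

lemma zeta_lip {s : ℂ} {h : ℝ} {U : ℝ} (hs : 1 < s.re) (hh : 0 ≤ h) (hs1 : 1/4 ≤ ‖s - 1‖)
    (hs2 : 1/4 ≤ ‖s + h - 1‖) (hU : 2 ≤ U) (hsU : ‖s + h‖ ≤ U) :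
    ‖riemannZeta s - riemannZeta (s + h)‖ ≤ 20 * U * h := by
  have hsh : 1 < (s + h).re := by simp; linarith
  rw [zeta_repr hs, zeta_repr hsh]
  have n1 : s - 1 ≠ 0 := by rw [← norm_pos_iff]; linarith
  have n2 : s + h - 1 ≠ 0 := by rw [← norm_pos_iff]; linarith
  have e : s / (s - 1) - s * fracInt s - ((s + h) / (s + h - 1) - (s + h) * fracInt (s + h))
    = h / ((s - 1) * (s + h - 1)) + (h * fracInt s - (s + h) * (fracInt s - fracInt (s + h))) := by
    field_simp
    ring
  have hn : ‖(h:ℂ)‖ = h := by rw [Complex.norm_real, Real.norm_eq_abs, abs_of_nonneg hh]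
  have b1 : ‖(h:ℂ) / ((s - 1) * (s + h - 1))‖ ≤ 16 * h := by
    rw [norm_div, norm_mul, hn, div_le_iff₀ (by positivity)]
    have : 1/4 * (1/4) ≤ ‖s - 1‖ * ‖s + h - 1‖ := by gcongr
    nlinarith
  have b2 : ‖(h:ℂ) * fracInt s‖ ≤ h := by
    rw [norm_mul, hn]
    have h1 : ‖fracInt s‖ ≤ 1 := (norm_fracInt_le (by linarith)).trans
      (by rw [div_le_one (by linarith)]; exact hs.le)
    nlinarith
  have b3 : ‖(s + h) * (fracInt s - fracInt (s + h))‖ ≤ U * (4 * h) := by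
    rw [norm_mul]
    gcongr
    exact fracInt_lip hs.le hh
  rw [e]
  calc _ ≤ _ := norm_add_le _ _
    _ ≤ 16 * h + (h + U * (4 * h)) := by
      gcongr
      exact (norm_sub_le _ _).trans (add_le_add b2 b3)
    _ ≤ _ := by nlinarith

lemma zeta_lower : ∃ c : ℝ, 0 < c ∧ ∀ d u : ℝ, 0 < d → d ≤ 1 →
    c / (2 + |u|) ^ 4 ≤ ‖riemannZeta (1 + d + u * Complex.I)‖ := by
  refine ⟨20 / 691200000, by norm_num, fun d u hd hd1 => ?_⟩
  set U := 2 + |u| with hU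
  have hU2 : 2 ≤ U := by linarith [abs_nonneg u]
  set η : ℝ := 1 / (691200000 * U ^ 5) with hη
  have hη0 : 0 < η := by positivity
  have hU5 : 1 ≤ U ^ 5 := one_le_pow₀ (by linarith)
  have hη1 : η ≤ 1/4 := by
    rw [hη, div_le_div_iff₀ (by positivity) (by norm_num)]; linarith
  have ec : 20 / 691200000 / U ^ 4 = 20 * U * η := by rw [hη]; field_simp
  rw [ec]
  by_cases hnear : d ≤ 1/4 ∧ |u| ≤ 1/4
  · have hs : 1 < (1 + d + u * Complex.I : ℂ).re := by simp [hd]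
    have hl := zeta_lower_near hs
    have e : (1 + d + u * Complex.I : ℂ) - 1 = d + u * Complex.I := by ring
    have h1 : ‖(1 + d + u * Complex.I : ℂ) - 1‖ ≤ 1/2 := by
      rw [e]
      refine (norm_add_le _ _).trans ?_
      rw [norm_mul, Complex.norm_real, Complex.norm_real, Complex.norm_I, Real.norm_eq_abs,
        Real.norm_eq_abs, abs_of_pos hd]
      linarith [hnear.1, hnear.2]
    have h0 : 0 < ‖(1 + d + u * Complex.I : ℂ) - 1‖ := by
      rw [e, norm_pos_iff]
      intro h
      have := congrArg Complex.re h
      simp at this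
      linarith
    have h2 : 2 ≤ 1 / ‖(1 + d + u * Complex.I : ℂ) - 1‖ := by
      rw [le_div_iff₀ h0]; linarith
    have h3 : 1 ≤ ‖(1 + d + u * Complex.I : ℂ)‖ := by
      have := Complex.abs_re_le_norm (1 + d + u * Complex.I : ℂ)
      simp at this
      linarith [le_abs_self (1 + d)]
    have h4 : 20 * U * η ≤ 1 := by
      rw [← ec, div_div, div_le_one (by positivity)]
      have : 1 ≤ U ^ 4 := one_le_pow₀ (by linarith)
      linarith
    refine h4.trans (le_trans ?_ hl)
    nlinarith
  · -- far
    have far : ∀ x : ℝ, η ≤ x → x ≤ 1 → (1/4 ≤ x ∨ 1/4 ≤ |u|) →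
        40 * U * η ≤ ‖riemannZeta (1 + x + u * Complex.I)‖ := by
      intro x hx hx1 hor
      have h1 := zeta_lower_341 (lt_of_lt_of_le hη0 hx) hx1 hor
      rw [← hU] at h1
      have h2 : η ^ 3 ≤ x ^ 3 := by gcongr
      have h3 : (40 * U * η) ^ 4 * (270 * U) = η ^ 3 := by
        rw [hη]; field_simp; norm_num
      have h4 : (40 * U * η) ^ 4 ≤ ‖riemannZeta (1 + x + u * Complex.I)‖ ^ 4 := by
        have : (40 * U * η) ^ 4 * (270 * U) ≤
            ‖riemannZeta (1 + x + u * Complex.I)‖ ^ 4 * (270 * U) := by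
          rw [h3]; linarith
        exact le_of_mul_le_mul_right this (by positivity)
      exact le_of_pow_le_pow_left₀ (by norm_num) (norm_nonneg _) h4
    by_cases hdη : η ≤ d
    · have := far d hdη hd1 (by
        by_contra hc
        push Not at hc
        exact hnear ⟨hc.1.le, hc.2.le⟩)
      have : 0 ≤ U * η := by positivity
      linarith
    · push Not at hdη
      have hu : 1/4 ≤ |u| := by
        by_contra hc
        push Not at hc
        exact hnear ⟨by linarith, hc.le⟩
      have h1 := far η le_rfl (by linarith) (Or.inr hu)
      have hs : 1 < (1 + d + u * Complex.I : ℂ).re := by simp [hd]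
      have e : (1 + d + u * Complex.I : ℂ) + ((η - d : ℝ) : ℂ) = 1 + η + u * Complex.I := by
        push_cast; ring
      have h2 := zeta_lip (s := 1 + d + u * Complex.I) (h := η - d) (U := U) hs (by linarith)
        (norm_sub_one_ge (Or.inr hu)) (by rw [e]; exact norm_sub_one_ge (Or.inr hu)) hU2
        (by rw [e]; exact norm_s_le hη0 (by linarith))
      rw [e] at h2
      have h3 := norm_sub_norm_le (riemannZeta (1 + η + u * Complex.I))
        (riemannZeta (1 + d + u * Complex.I))
      rw [norm_sub_rev] at h3
      have h4 : 20 * U * (η - d) ≤ 20 * U * η := by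
        gcongr; linarith
      linarith


lemma prime_two_le (p : Nat.Primes) : (2:ℝ) ≤ (p:ℕ) := by exact_mod_cast p.2.two_le

lemma prime_cpow_norm (p : Nat.Primes) (s : ℂ) : ‖((p:ℕ):ℂ) ^ (-s)‖ = ((p:ℕ):ℝ) ^ (-s.re) := by
  rw [Complex.norm_natCast_cpow_of_pos p.2.pos]; simp

lemma prime_cpow_re (p : ℕ) (hp : 0 < p) (a u : ℝ) :
    ((p:ℂ) ^ (-(a + u * Complex.I : ℂ))).re = (p:ℝ) ^ (-a) * Real.cos (u * Real.log p) := by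
  have hp0 : (0:ℝ) < (p:ℕ) := by exact_mod_cast hp
  rw [Complex.cpow_def_of_ne_zero (by exact_mod_cast hp0.ne'), ← Complex.ofReal_natCast, ← Complex.ofReal_log hp0.le,
    Complex.exp_re, Real.rpow_def_of_pos hp0]
  simp only [Complex.mul_re, Complex.mul_im, Complex.neg_re, Complex.neg_im, Complex.add_re,
    Complex.add_im, Complex.ofReal_re, Complex.ofReal_im, Complex.I_re, Complex.I_im]
  rw [← Real.cos_neg (u * Real.log p)]
  ring_nf

lemma summable_prime_cos {d : ℝ} (hd : 0 < d) (u : ℝ) :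
    Summable (fun p : Nat.Primes => ((p:ℕ):ℝ) ^ (-(1 + d)) * Real.cos (u * Real.log (p:ℕ))) := by
  refine Summable.of_norm_bounded (g := fun p : Nat.Primes => ((p:ℕ):ℝ) ^ (-(1 + d)))
    (Nat.Primes.summable_rpow.2 (by linarith)) fun p => ?_
  have h0 : 0 ≤ ((p:ℕ):ℝ) ^ (-(1 + d)) := by positivity
  rw [norm_mul, Real.norm_eq_abs, Real.norm_eq_abs, abs_of_nonneg h0]
  nlinarith [Real.abs_cos_le_one (u * Real.log (p:ℕ))]

lemma log_zeta : ∃ C : ℝ, 0 ≤ C ∧ ∀ d u : ℝ, 0 < d →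
    |Real.log ‖riemannZeta (1 + d + u * Complex.I)‖ -
      ∑' p : Nat.Primes, ((p:ℕ):ℝ) ^ (-(1 + d)) * Real.cos (u * Real.log (p:ℕ))| ≤ C := by
  have hsum2 : Summable (fun p : Nat.Primes => ((p:ℕ):ℝ) ^ (-2:ℝ)) :=
    Nat.Primes.summable_rpow.2 (by norm_num)
  refine ⟨∑' p : Nat.Primes, ((p:ℕ):ℝ) ^ (-2:ℝ), tsum_nonneg fun p => by positivity,
    fun d u hd => ?_⟩
  set s : ℂ := 1 + d + u * Complex.I with hsdef
  have hsre : s.re = 1 + d := by simp [hsdef]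
  have hs : 1 < s.re := by rw [hsre]; linarith
  have hnorm : ∀ p : Nat.Primes, ‖((p:ℕ):ℂ) ^ (-s)‖ ≤ 1/2 := by
    intro p
    rw [prime_cpow_norm, hsre]
    have h2 := prime_two_le p
    calc ((p:ℕ):ℝ) ^ (-(1 + d)) ≤ ((p:ℕ):ℝ) ^ (-1:ℝ) :=
          Real.rpow_le_rpow_of_exponent_le (by linarith) (by linarith)
      _ = 1 / ((p:ℕ):ℝ) := by rw [Real.rpow_neg_one]; simp
      _ ≤ 1/2 := by gcongr
  have hdiff : ∀ p : Nat.Primes, ‖(-Complex.log (1 - ((p:ℕ):ℂ) ^ (-s))) - ((p:ℕ):ℂ) ^ (-s)‖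
      ≤ ((p:ℕ):ℝ) ^ (-2:ℝ) := by
    intro p
    have h1 := Complex.norm_log_one_add_sub_self_le (z := -((p:ℕ):ℂ) ^ (-s))
      (by rw [norm_neg]; linarith [hnorm p])
    rw [norm_neg, ← sub_eq_add_neg] at h1
    have e : (-Complex.log (1 - ((p:ℕ):ℂ) ^ (-s))) - ((p:ℕ):ℂ) ^ (-s)
      = -(Complex.log (1 - ((p:ℕ):ℂ) ^ (-s)) - -((p:ℕ):ℂ) ^ (-s)) := by ring
    rw [e, norm_neg]
    refine h1.trans ?_
    have h3 := hnorm p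
    have h4 : (1 - ‖((p:ℕ):ℂ) ^ (-s)‖)⁻¹ ≤ 2 := by
      rw [inv_le_comm₀ (by linarith) (by norm_num)]; linarith
    have h5 : ‖((p:ℕ):ℂ) ^ (-s)‖ ^ 2 ≤ ((p:ℕ):ℝ) ^ (-2:ℝ) := by
      rw [prime_cpow_norm, hsre, ← Real.rpow_natCast, ← Real.rpow_mul (by positivity)]
      have h2 := prime_two_le p
      exact Real.rpow_le_rpow_of_exponent_le (by linarith) (by push_cast; linarith)
    calc _ ≤ ‖((p:ℕ):ℂ) ^ (-s)‖ ^ 2 * 2 / 2 := by gcongr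
      _ ≤ _ := by linarith
  have hS1 : Summable (fun p : Nat.Primes => ((p:ℕ):ℂ) ^ (-s)) := by
    refine Summable.of_norm ?_
    simp_rw [prime_cpow_norm, hsre]
    exact Nat.Primes.summable_rpow.2 (by linarith)
  have hS2 : Summable (fun p : Nat.Primes =>
      (-Complex.log (1 - ((p:ℕ):ℂ) ^ (-s))) - ((p:ℕ):ℂ) ^ (-s)) :=
    Summable.of_norm_bounded hsum2 hdiff
  have hS3 : Summable (fun p : Nat.Primes => (-Complex.log (1 - ((p:ℕ):ℂ) ^ (-s)))) := by
    have := hS2.add hS1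
    simpa using this
  have hz := riemannZeta_eulerProduct_exp_log hs
  have hlog : Real.log ‖riemannZeta s‖ =
      (∑' p : Nat.Primes, (-Complex.log (1 - ((p:ℕ):ℂ) ^ (-s)))).re := by
    rw [← hz, Complex.norm_exp, Real.log_exp]
  have hre : ∑' p : Nat.Primes, ((p:ℕ):ℝ) ^ (-(1 + d)) * Real.cos (u * Real.log (p:ℕ))
      = (∑' p : Nat.Primes, ((p:ℕ):ℂ) ^ (-s)).re := by
    rw [Complex.re_tsum hS1]
    congr 1
    ext p
    have := prime_cpow_re p p.2.pos (1 + d) u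
    rw [← this]
    push_cast
    rfl
  rw [hlog, hre, ← Complex.sub_re, ← hS3.tsum_sub hS1]
  refine (Complex.abs_re_le_norm _).trans ?_
  exact tsum_of_norm_bounded hsum2.hasSum hdiff

lemma log_prime_sum : ∃ C : ℝ, 0 ≤ C ∧ ∀ d : ℝ, 0 < d → d ≤ 1 → ∀ s : Finset Nat.Primes,
    d * ∑ p ∈ s, Real.log (p:ℕ) * ((p:ℕ):ℝ) ^ (-(1 + d)) ≤ C := by
  obtain ⟨C, hC0, hC⟩ := log_zeta
  refine ⟨2 * (Real.log 4 + 2 * C), by positivity, fun d hd hd1 s => ?_⟩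
  have hlt : ∀ e : ℝ, 0 < e → Summable (fun p : Nat.Primes => ((p:ℕ):ℝ) ^ (-(1 + e))) :=
    fun e he => Nat.Primes.summable_rpow.2 (by linarith)
  have key : ∀ p : Nat.Primes, d / 2 * (Real.log (p:ℕ) * ((p:ℕ):ℝ) ^ (-(1 + d)))
      ≤ ((p:ℕ):ℝ) ^ (-(1 + d/2)) - ((p:ℕ):ℝ) ^ (-(1 + d)) := by
    intro p
    have hp : (0:ℝ) < (p:ℕ) := by linarith [prime_two_le p]
    have e : ((p:ℕ):ℝ) ^ (-(1 + d/2)) = ((p:ℕ):ℝ) ^ (-(1 + d)) * ((p:ℕ):ℝ) ^ (d/2) := by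
      rw [← Real.rpow_add hp]; ring_nf
    have h1 : 1 + d / 2 * Real.log (p:ℕ) ≤ ((p:ℕ):ℝ) ^ (d/2) := by
      rw [Real.rpow_def_of_pos hp]
      linarith [Real.add_one_le_exp (Real.log (p:ℕ) * (d/2))]
    have h0 : 0 ≤ ((p:ℕ):ℝ) ^ (-(1 + d)) := by positivity
    rw [e]
    nlinarith
  have h1 : d / 2 * ∑ p ∈ s, Real.log (p:ℕ) * ((p:ℕ):ℝ) ^ (-(1 + d)) ≤
      ∑' p : Nat.Primes, (((p:ℕ):ℝ) ^ (-(1 + d/2)) - ((p:ℕ):ℝ) ^ (-(1 + d))) := by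
    rw [Finset.mul_sum]
    refine (Finset.sum_le_sum fun p _ => key p).trans ?_
    refine Summable.sum_le_tsum s (fun p _ => ?_) ((hlt _ (by linarith)).sub (hlt _ hd))
    have := key p
    have h0 : 0 ≤ d / 2 * (Real.log (p:ℕ) * ((p:ℕ):ℝ) ^ (-(1 + d))) := by
      have := Real.log_natCast_nonneg (p:ℕ)
      positivity
    linarith
  rw [(hlt _ (by linarith)).tsum_sub (hlt _ hd)] at h1
  have a1 := hC (d/2) 0 (by linarith)
  have a2 := hC d 0 hd
  simp only [zero_mul, Real.cos_zero, mul_one, Complex.ofReal_zero, add_zero] at a1 a2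
  have z1 : Real.log ‖riemannZeta (1 + (d/2:ℝ))‖ ≤ Real.log (4 / d) := by
    apply Real.log_le_log
    · exact lt_of_lt_of_le (by positivity) (zeta_real_lower (by linarith : 0 < d/2))
    · refine (zeta_real_upper (by linarith : 0 < d/2)).trans ?_
      rw [le_div_iff₀ hd]; field_simp; linarith
  have z2 : Real.log (1 / d) ≤ Real.log ‖riemannZeta (1 + d)‖ :=
    Real.log_le_log (by positivity) (zeta_real_lower hd)
  rw [Real.log_div (by norm_num) hd.ne'] at z1 z2
  rw [Real.log_one] at z2
  have b1 := (abs_le.1 a1).1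
  have b2 := (abs_le.1 a2).2
  have b1' := (abs_le.1 a1).2
  have b2' := (abs_le.1 a2).1
  linarith

/-- primes below the cutoff `exp (1/d)`. -/
def cut (d : ℝ) : ℕ := ⌊Real.exp (1 / d)⌋₊ + 1

lemma lt_cut {d : ℝ} {p : ℕ} : p < cut d ↔ (p:ℝ) ≤ Real.exp (1/d) := by
  unfold cut
  rw [Nat.lt_succ_iff, Nat.le_floor_iff (Real.exp_pos _).le]

def primesB (n : ℕ) : Finset Nat.Primes := (Finset.range n).subtype Nat.Prime

lemma mem_primesB {n : ℕ} {p : Nat.Primes} : p ∈ primesB n ↔ (p:ℕ) < n := by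
  unfold primesB
  have := @Finset.mem_subtype ℕ Nat.Prime _ (Finset.range n) p
  rw [Finset.mem_range] at this
  exact this

lemma sum_primes_eq (n : ℕ) (g : ℕ → ℝ) :
    ∑ i ∈ Finset.range n, (if i.Prime then g i else 0) =
      ∑ p ∈ primesB n, g (p:ℕ) := by
  rw [← Finset.sum_filter]
  exact (Finset.sum_subtype_eq_sum_filter (s := Finset.range n) (p := Nat.Prime) g).symm

lemma log_div_prime_sum : ∃ C : ℝ, 0 ≤ C ∧ ∀ d : ℝ, 0 < d → d ≤ 1 →
    d * ∑ i ∈ Finset.range (cut d), (if i.Prime then Real.log i / i else 0) ≤ C := by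
  obtain ⟨C, hC0, hC⟩ := log_prime_sum
  refine ⟨Real.exp 1 * C, by positivity, fun d hd hd1 => ?_⟩
  rw [sum_primes_eq _ (fun i => Real.log i / i)]
  refine le_trans ?_ (mul_le_mul_of_nonneg_left
    (hC d hd hd1 (primesB (cut d))) (Real.exp_pos 1).le)
  rw [mul_left_comm, Finset.mul_sum (a := Real.exp 1)]
  refine mul_le_mul_of_nonneg_left (Finset.sum_le_sum fun p hp => ?_) hd.le
  rw [mem_primesB, lt_cut] at hp
  have hp0 : (0:ℝ) < (p:ℕ) := by linarith [prime_two_le p]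
  have hl : Real.log (p:ℕ) ≤ 1 / d := by
    rw [Real.log_le_iff_le_exp hp0]; exact hp
  have h1 : ((p:ℕ):ℝ) ^ (-(1 + d)) = ((p:ℕ):ℝ)⁻¹ * Real.exp (-(Real.log (p:ℕ) * d)) := by
    rw [neg_add, Real.rpow_add hp0, Real.rpow_neg_one, Real.rpow_def_of_pos hp0 (-d)]
    ring_nf
  have h2 : 1 ≤ Real.exp 1 * Real.exp (-(Real.log (p:ℕ) * d)) := by
    rw [← Real.exp_add]
    apply Real.one_le_exp
    have : Real.log (p:ℕ) * d ≤ 1 / d * d := by gcongr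
    rw [one_div_mul_cancel hd.ne'] at this
    linarith
  rw [h1, div_eq_mul_inv]
  have h3 : 0 ≤ Real.log (p:ℕ) * ((p:ℕ):ℝ)⁻¹ := by
    have := Real.log_natCast_nonneg (p:ℕ)
    positivity
  nlinarith

lemma cos_prime_sum : ∃ C : ℝ, 0 ≤ C ∧ ∀ d u : ℝ, 0 < d → d ≤ 1 →
    |∑ i ∈ Finset.range (cut d), (if i.Prime then Real.cos (u * Real.log i) / i else 0) -
      Real.log ‖riemannZeta (1 + d + u * Complex.I)‖| ≤ C := by
  obtain ⟨C1, hC10, hC1⟩ := log_zeta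
  obtain ⟨C2, hC20, hC2⟩ := log_prime_sum
  obtain ⟨C3, hC30, hC3⟩ := log_div_prime_sum
  refine ⟨C3 + C2 + C1, by positivity, fun d u hd hd1 => ?_⟩
  set s0 := primesB (cut d) with hs0
  set F : Nat.Primes → ℝ := fun p => ((p:ℕ):ℝ) ^ (-(1 + d)) * Real.cos (u * Real.log (p:ℕ)) with hF
  have h1 : |∑ p ∈ s0, F p - ∑' p, F p| ≤ C2 := by
    have hs := (summable_prime_cos hd u).hasSum
    have ht : Filter.Tendsto (fun s : Finset Nat.Primes => |∑ p ∈ s0, F p - ∑ p ∈ s, F p|)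
        Filter.atTop (nhds |∑ p ∈ s0, F p - ∑' p, F p|) := (tendsto_const_nhds.sub hs).abs
    refine le_of_tendsto ht ?_
    filter_upwards [Filter.eventually_ge_atTop s0] with s hss
    have e : ∑ p ∈ s0, F p - ∑ p ∈ s, F p = - ∑ p ∈ s \ s0, F p := by
      rw [← Finset.sum_sdiff hss]; ring
    rw [e, abs_neg]
    refine (Finset.abs_sum_le_sum_abs _ _).trans (le_trans ?_ (hC2 d hd hd1 (s \ s0)))
    rw [Finset.mul_sum]
    refine Finset.sum_le_sum fun p hp => ?_
    have hp' := (Finset.mem_sdiff.1 hp).2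
    rw [hs0, mem_primesB, lt_cut, not_le] at hp'
    have hp0 : (0:ℝ) < (p:ℕ) := by linarith [prime_two_le p]
    have hl : 1 / d ≤ Real.log (p:ℕ) := by
      rw [Real.le_log_iff_exp_le hp0]; exact hp'.le
    have hl2 : 1 ≤ d * Real.log (p:ℕ) := by
      rw [div_le_iff₀ hd] at hl; linarith
    have h0 : 0 ≤ ((p:ℕ):ℝ) ^ (-(1 + d)) := by positivity
    rw [hF]
    simp only
    rw [abs_mul, abs_of_nonneg h0]
    have := Real.abs_cos_le_one (u * Real.log (p:ℕ))
    nlinarith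
  have h2 : |∑ p ∈ s0, Real.cos (u * Real.log (p:ℕ)) / (p:ℕ) - ∑ p ∈ s0, F p| ≤ C3 := by
    rw [← Finset.sum_sub_distrib]
    refine (Finset.abs_sum_le_sum_abs _ _).trans (le_trans ?_ (hC3 d hd hd1))
    rw [sum_primes_eq _ (fun i => Real.log i / i), Finset.mul_sum]
    refine Finset.sum_le_sum fun p hp => ?_
    have hp0 : (0:ℝ) < (p:ℕ) := by linarith [prime_two_le p]
    have h1 : ((p:ℕ):ℝ) ^ (-(1 + d)) = ((p:ℕ):ℝ)⁻¹ * Real.exp (-(Real.log (p:ℕ) * d)) := by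
      rw [neg_add, Real.rpow_add hp0, Real.rpow_neg_one, Real.rpow_def_of_pos hp0 (-d)]
      ring_nf
    have hlog := Real.log_natCast_nonneg (p:ℕ)
    have hx := Real.add_one_le_exp (-(Real.log (p:ℕ) * d))
    have hx1 : Real.exp (-(Real.log (p:ℕ) * d)) ≤ 1 := Real.exp_le_one_iff.2 (by
      have : 0 ≤ Real.log (p:ℕ) * d := by positivity
      linarith)
    have e : Real.cos (u * Real.log (p:ℕ)) / (p:ℕ) - F p =
      ((p:ℕ):ℝ)⁻¹ * (Real.cos (u * Real.log (p:ℕ)) * (1 - Real.exp (-(Real.log (p:ℕ) * d)))) := by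
      rw [hF]; simp only; rw [h1]; ring
    rw [e, abs_mul, abs_mul, abs_of_nonneg (inv_nonneg.2 hp0.le),
      abs_of_nonneg (by linarith : 0 ≤ 1 - Real.exp (-(Real.log (p:ℕ) * d)))]
    have := Real.abs_cos_le_one (u * Real.log (p:ℕ))
    have h5 : |Real.cos (u * Real.log (p:ℕ))| * (1 - Real.exp (-(Real.log (p:ℕ) * d)))
      ≤ 1 * (Real.log (p:ℕ) * d) := by
      gcongr
      linarith
    calc _ ≤ ((p:ℕ):ℝ)⁻¹ * (1 * (Real.log (p:ℕ) * d)) := by gcongr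
      _ = _ := by ring
  have h3 := hC1 d u hd
  rw [sum_primes_eq _ (fun i => Real.cos (u * Real.log i) / i)]
  rw [abs_le] at h1 h2 h3 ⊢
  constructor <;> linarith [h1.1, h1.2, h2.1, h2.2, h3.1, h3.2]

lemma cos_prime_sum_ge : ∃ C : ℝ, 0 ≤ C ∧ ∀ d u : ℝ, 0 < d → d ≤ 1 →
    -(C * (1 + Real.log (2 + |u|))) ≤
    ∑ i ∈ Finset.range (cut d), (if i.Prime then Real.cos (u * Real.log i) / i else 0) := by
  obtain ⟨C1, hC10, hC1⟩ := cos_prime_sum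
  obtain ⟨c, hc0, hc⟩ := zeta_lower
  refine ⟨C1 + |Real.log c| + 4, by positivity, fun d u hd hd1 => ?_⟩
  have h1 := (abs_le.1 (hC1 d u hd hd1)).1
  have hU : (0:ℝ) < 2 + |u| := by positivity
  have h2 := Real.log_le_log (by positivity) (hc d u hd hd1)
  rw [Real.log_div hc0.ne' (by positivity), Real.log_pow] at h2
  have hl : 0 ≤ Real.log (2 + |u|) := Real.log_nonneg (by linarith [abs_nonneg u])
  have h3 := neg_abs_le (Real.log c)
  have h4 : 0 ≤ (C1 + |Real.log c|) * Real.log (2 + |u|) := by positivity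
  push_cast at h2
  nlinarith

lemma inv_prime_sum : ∃ C : ℝ, 0 ≤ C ∧ ∀ d : ℝ, 0 < d → d ≤ 1 →
    |∑ i ∈ Finset.range (cut d), (if i.Prime then 1 / (i:ℝ) else 0) - Real.log (1 / d)| ≤ C := by
  obtain ⟨C1, hC10, hC1⟩ := cos_prime_sum
  refine ⟨C1 + Real.log 3, by positivity, fun d hd hd1 => ?_⟩
  have h1 := hC1 d 0 hd hd1
  simp only [zero_mul, Real.cos_zero, Complex.ofReal_zero, add_zero] at h1
  have z1 : Real.log ‖riemannZeta (1 + d)‖ ≤ Real.log (3 / d) := by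
    apply Real.log_le_log
    · exact lt_of_lt_of_le (by positivity) (zeta_real_lower hd)
    · refine (zeta_real_upper hd).trans ?_
      rw [le_div_iff₀ hd]; field_simp; linarith
  have z2 : Real.log (1 / d) ≤ Real.log ‖riemannZeta (1 + d)‖ :=
    Real.log_le_log (by positivity) (zeta_real_lower hd)
  have e : Real.log (3 / d) = Real.log 3 + Real.log (1 / d) := by
    rw [← Real.log_mul (by norm_num) (by positivity)]; ring_nf
  have h3 : 0 ≤ Real.log 3 := Real.log_nonneg (by norm_num)
  rw [abs_le] at h1 ⊢
  constructor <;> linarith [h1.1, h1.2]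


/-- The summatory function of the truncated random multiplicative function in log scale. -/
def Sst (b : ℕ → Bool) : ℕ → ℝ → ℝ
  | 0, v => if 0 ≤ v then 1 else 0
  | n + 1, v => Sst b n v + (if n.Prime then sg (b n) * Sst b n (v - Real.log n) else 0)

/-- The Euler product over primes below `n`. -/
def Ff (b : ℕ → Bool) (n : ℕ) (s : ℂ) : ℂ :=
  ∏ i ∈ Finset.range n, (if i.Prime then 1 + (sg (b i) : ℂ) * (i : ℂ) ^ (-s) else 1)

def en (n : ℕ) : ℝ := ∏ i ∈ Finset.range n, (if i.Prime then 1 + 1 / (i : ℝ) else 1)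

def Nn (n : ℕ) (b : ℕ → Bool) : ℝ := ∫ v, (Sst b n v) ^ 2 * Real.exp (-v)

lemma abs_sg (x : Bool) : |sg x| = 1 := by cases x <;> simp

lemma Sst_meas (b : ℕ → Bool) (n : ℕ) : Measurable (Sst b n) := by
  induction n with
  | zero => exact Measurable.ite measurableSet_Ici measurable_const measurable_const
  | succ n ih =>
    by_cases hn : n.Prime
    · have : Sst b (n+1) = fun v => Sst b n v + sg (b n) * Sst b n (v - Real.log n) := by
        funext v; simp [Sst, hn]
      rw [this]
      exact ih.add ((ih.comp (measurable_id.sub_const _)).const_mul _)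
    · have : Sst b (n+1) = Sst b n := by
        funext v; simp [Sst, hn]
      rw [this]; exact ih

lemma Sst_neg (b : ℕ → Bool) (n : ℕ) : ∀ v < 0, Sst b n v = 0 := by
  induction n with
  | zero => intro v hv; simp [Sst, hv]
  | succ n ih =>
    intro v hv
    have := Real.log_natCast_nonneg n
    simp [Sst, ih v hv, ih (v - Real.log n) (by linarith)]

lemma Sst_bound (b : ℕ → Bool) (n : ℕ) : ∀ v, |Sst b n v| ≤ 2 ^ n := by
  induction n with
  | zero => intro v; simp only [Sst]; split_ifs <;> simp
  | succ n ih =>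
    intro v
    simp only [Sst]
    refine (abs_add_le _ _).trans ?_
    have h2 : |if n.Prime then sg (b n) * Sst b n (v - Real.log n) else 0| ≤ 2 ^ n := by
      split_ifs
      · rw [abs_mul, abs_sg, one_mul]; exact ih _
      · simp
    rw [pow_succ]
    linarith [ih v]

lemma Sst_dep (n : ℕ) : Dep n (fun b => Sst b n) := by
  induction n with
  | zero => intro b b' _; funext v; simp [Sst]
  | succ n ih =>
    intro b b' hb
    have h := ih b b' fun i hi => hb i (by omega)
    simp only at h
    funext v
    simp only [Sst, h, hb n (by omega)]

lemma expInt {σ : ℝ} (hσ : 0 < σ) :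
    IntegrableOn (fun v : ℝ => Real.exp (-(σ * v))) (Set.Ici 0) := by
  rw [integrableOn_Ici_iff_integrableOn_Ioi]
  have := integrableOn_exp_mul_Ioi (a := -σ) (by linarith) 0
  simpa using this

lemma integrable_of_supp {E : Type*} [NormedAddCommGroup E] {f : ℝ → E} {M σ : ℝ} (hσ : 0 < σ)
    (hf : AEStronglyMeasurable f volume) (h0 : ∀ v < 0, f v = 0)
    (hb : ∀ v, ‖f v‖ ≤ M * Real.exp (-(σ * v))) : Integrable f := by
  have h1 : Integrable ((Set.Ici (0:ℝ)).indicator (fun v => M * Real.exp (-(σ * v)))) :=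
    (integrable_indicator_iff measurableSet_Ici).2 ((expInt hσ).const_mul M)
  refine h1.mono' hf (Filter.Eventually.of_forall fun v => ?_)
  by_cases hv : 0 ≤ v
  · rw [Set.indicator_of_mem (Set.mem_Ici.2 hv)]; exact hb v
  · rw [Set.indicator_of_notMem (by simpa using hv), h0 v (not_le.1 hv), norm_zero]

lemma norm_exp_neg_mul (s : ℂ) (v : ℝ) : ‖Complex.exp (-(s * v))‖ = Real.exp (-(s.re * v)) := by
  rw [Complex.norm_exp]; simp

lemma Sst_laplace_int (b : ℕ → Bool) (n : ℕ) {s : ℂ} (hs : 0 < s.re) :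
    Integrable (fun v : ℝ => (Sst b n v : ℂ) * Complex.exp (-(s * v))) := by
  refine integrable_of_supp (M := 2 ^ n) hs ?_ ?_ ?_
  · refine Measurable.aestronglyMeasurable ?_
    have := Sst_meas b n
    exact (Complex.measurable_ofReal.comp this).mul (by fun_prop)
  · intro v hv; simp [Sst_neg b n v hv]
  · intro v
    rw [norm_mul, norm_exp_neg_mul, Complex.norm_real]
    gcongr
    exact Sst_bound b n v

lemma Ff_succ (b : ℕ → Bool) (n : ℕ) (s : ℂ) : Ff b (n+1) s =
    Ff b n s * (if n.Prime then 1 + (sg (b n) : ℂ) * (n : ℂ) ^ (-s) else 1) := by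
  simp [Ff, Finset.prod_range_succ]

lemma Sst_laplace (b : ℕ → Bool) (n : ℕ) {s : ℂ} (hs : 0 < s.re) :
    ∫ v : ℝ, (Sst b n v : ℂ) * Complex.exp (-(s * v)) = Ff b n s / s := by
  have hs0 : s ≠ 0 := by
    intro h; rw [h] at hs; simp at hs
  induction n with
  | zero =>
    have e : (fun v : ℝ => (Sst b 0 v : ℂ) * Complex.exp (-(s * v))) =
        (Set.Ici (0:ℝ)).indicator (fun v : ℝ => Complex.exp (-s * v)) := by
      funext v
      by_cases hv : 0 ≤ v
      · rw [Set.indicator_of_mem (Set.mem_Ici.2 hv)]; simp [Sst, hv]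
      · rw [Set.indicator_of_notMem (by simpa using hv)]; simp [Sst, hv]
    rw [e, integral_indicator measurableSet_Ici, integral_Ici_eq_integral_Ioi,
      integral_exp_mul_complex_Ioi (by simpa using hs)]
    simp [Ff]
  | succ n ih =>
    rw [Ff_succ]
    by_cases hn : n.Prime
    · have hshift : ∫ v : ℝ, (Sst b n (v - Real.log n) : ℂ) * Complex.exp (-(s * v)) =
          (n:ℂ) ^ (-s) * (Ff b n s / s) := by
        rw [← ih, ← integral_const_mul]
        rw [← integral_sub_right_eq_self (fun v : ℝ => (n:ℂ) ^ (-s) *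
          ((Sst b n v : ℂ) * Complex.exp (-(s * v)))) (Real.log n)]
        congr 1
        funext v
        have : (n:ℂ) ^ (-s) = Complex.exp (-(s * (Real.log n : ℝ))) := by
          rw [Complex.cpow_def_of_ne_zero (by exact_mod_cast hn.ne_zero), ← Complex.natCast_log]
          ring_nf
        rw [this, mul_left_comm, ← Complex.exp_add]
        congr 2
        push_cast; ring
      have hIntg : Integrable (fun v : ℝ => (sg (b n) : ℂ) * ((Sst b n (v - Real.log n) : ℂ) *
          Complex.exp (-(s * v)))) := by
        refine Integrable.const_mul ?_ _
        refine integrable_of_supp (M := 2 ^ n) hs ?_ ?_ ?_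
        · refine Measurable.aestronglyMeasurable ?_
          have := (Sst_meas b n).comp (measurable_id.sub_const (Real.log n))
          exact (Complex.measurable_ofReal.comp this).mul (by fun_prop)
        · intro v hv
          have := Real.log_natCast_nonneg n
          simp [Sst_neg b n (v - Real.log n) (by linarith)]
        · intro v
          rw [norm_mul, norm_exp_neg_mul, Complex.norm_real]
          gcongr
          exact Sst_bound b n _
      have e : (fun v : ℝ => (Sst b (n+1) v : ℂ) * Complex.exp (-(s * v))) = fun v : ℝ =>
          (Sst b n v : ℂ) * Complex.exp (-(s * v)) + (sg (b n) : ℂ) *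
            ((Sst b n (v - Real.log n) : ℂ) * Complex.exp (-(s * v))) := by
        funext v
        simp only [Sst, hn, if_true]
        push_cast; ring
      rw [e, integral_add (Sst_laplace_int b n hs) hIntg, ih, integral_const_mul, hshift]
      simp only [hn, if_true]
      ring
    · simp only [Sst, hn, if_false, add_zero, mul_one]
      exact ih

lemma Sst_sq_int (b : ℕ → Bool) (n : ℕ) :
    Integrable (fun v : ℝ => (Sst b n v) ^ 2 * Real.exp (-v)) := by
  refine integrable_of_supp (M := (2 ^ n) ^ 2) one_pos ?_ ?_ ?_
  · refine Measurable.aestronglyMeasurable ?_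
    have := Sst_meas b n
    fun_prop
  · intro v hv; simp [Sst_neg b n v hv]
  · intro v
    rw [norm_mul, one_mul, Real.norm_eq_abs, Real.norm_eq_abs, abs_of_pos (Real.exp_pos _), abs_pow]
    gcongr
    exact Sst_bound b n v

lemma Nn_nonneg (n : ℕ) (b : ℕ → Bool) : 0 ≤ Nn n b :=
  integral_nonneg fun v => by positivity

lemma Nn_dep (n : ℕ) : Dep n (Nn n) := fun b b' hb => by
  have := Sst_dep n b b' hb
  simp only at this
  simp only [Nn, this]

lemma Nn_zero (b : ℕ → Bool) : Nn 0 b = 1 := by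
  unfold Nn
  have e : (fun v : ℝ => (Sst b 0 v) ^ 2 * Real.exp (-v)) =
      (Set.Ici (0:ℝ)).indicator (fun v : ℝ => Real.exp (-v)) := by
    funext v
    by_cases hv : 0 ≤ v
    · rw [Set.indicator_of_mem (Set.mem_Ici.2 hv)]; simp [Sst, hv]
    · rw [Set.indicator_of_notMem (by simpa using hv)]; simp [Sst, hv]
  rw [e, integral_indicator measurableSet_Ici, integral_Ici_eq_integral_Ioi,
    integral_exp_neg_Ioi_zero]

lemma Nn_avg (n : ℕ) (hn : n.Prime) (b : ℕ → Bool) :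
    1/2 * Nn (n+1) (Function.update b n true) + 1/2 * Nn (n+1) (Function.update b n false)
      = (1 + 1/(n:ℝ)) * Nn n b := by
  have hn0 : (0:ℝ) < n := by exact_mod_cast hn.pos
  have hshift : ∫ v : ℝ, (Sst b n (v - Real.log n)) ^ 2 * Real.exp (-v) = 1/(n:ℝ) * Nn n b := by
    unfold Nn
    rw [← integral_const_mul]
    rw [← integral_sub_right_eq_self (fun v : ℝ => 1/(n:ℝ) *
      ((Sst b n v) ^ 2 * Real.exp (-v))) (Real.log n)]
    congr 1
    funext v
    have : 1/(n:ℝ) = Real.exp (-Real.log n) := by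
      rw [Real.exp_neg, Real.exp_log hn0]; simp
    rw [this, mul_left_comm, ← Real.exp_add]
    ring_nf
  have hIntg : Integrable (fun v : ℝ => (Sst b n (v - Real.log n)) ^ 2 * Real.exp (-v)) := by
    refine integrable_of_supp (M := (2 ^ n) ^ 2) one_pos ?_ ?_ ?_
    · refine Measurable.aestronglyMeasurable ?_
      have := (Sst_meas b n).comp (measurable_id.sub_const (Real.log n))
      exact (this.pow_const 2).mul (by fun_prop)
    · intro v hv
      have := Real.log_natCast_nonneg n
      simp [Sst_neg b n (v - Real.log n) (by linarith)]
    · intro v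
      rw [norm_mul, one_mul, Real.norm_eq_abs, Real.norm_eq_abs, abs_of_pos (Real.exp_pos _),
        abs_pow]
      gcongr
      exact Sst_bound b n _
  have hd : ∀ x, Sst (Function.update b n x) n = Sst b n := fun x => (Sst_dep n).update le_rfl b x
  have e : ∀ v : ℝ, 1/2 * ((Sst (Function.update b n true) (n+1) v) ^ 2 * Real.exp (-v)) +
      1/2 * ((Sst (Function.update b n false) (n+1) v) ^ 2 * Real.exp (-v)) =
      (Sst b n v) ^ 2 * Real.exp (-v) + (Sst b n (v - Real.log n)) ^ 2 * Real.exp (-v) := by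
    intro v
    simp only [Sst, hd, hn, if_true, Function.update_self, sg_true, sg_false]
    ring
  rw [add_mul, one_mul, ← hshift]
  unfold Nn
  rw [← integral_add (Sst_sq_int b n) hIntg]
  simp_rw [← e]
  rw [integral_add ((Sst_sq_int _ _).const_mul _) ((Sst_sq_int _ _).const_mul _),
    integral_const_mul, integral_const_mul]

lemma Nn_nonprime (n : ℕ) (hn : ¬ n.Prime) (b : ℕ → Bool) (x : Bool) :
    Nn (n+1) (Function.update b n x) = Nn n b := by
  have hd : Sst (Function.update b n x) n = Sst b n := (Sst_dep n).update le_rfl b x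
  simp [Nn, Sst, hn, hd]

lemma en_pos (n : ℕ) : 0 < en n := Finset.prod_pos fun i _ => by split_ifs <;> positivity

lemma en_succ (n : ℕ) : en (n+1) = en n * (if n.Prime then 1 + 1 / (n : ℝ) else 1) := by
  simp [en, Finset.prod_range_succ]

def w0 (i : ℕ) : ℝ := if i.Prime then 1/2 else 1

lemma w0_nonneg (i : ℕ) : 0 ≤ w0 i := by unfold w0; split_ifs <;> norm_num
lemma w0_le_one (i : ℕ) : w0 i ≤ 1 := by unfold w0; split_ifs <;> norm_num

lemma good_prob (A : ℝ) (N : ℕ) :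
    A * Ex w0 N (fun b => open Classical in if ∃ n ≤ N, A < Nn n b / en n then 1 else 0) ≤ 1 := by
  refine Ex_maximal w0_nonneg w0_le_one (fun n b => Nn n b / en n)
    (fun n b => div_nonneg (Nn_nonneg n b) (en_pos n).le)
    (fun n => (Nn_dep n).comp (fun x => x / en n)) ?_ A 1 (fun b => by simp [Nn_zero, en]) N
  intro n b
  have h0 := en_pos n
  by_cases hn : n.Prime
  · have := Nn_avg n hn b
    have h1 : (0:ℝ) < 1 + 1 / (n:ℝ) := by positivity
    simp only [w0, hn, if_true, en_succ]
    rw [show (1 - 1/2 : ℝ) = 1/2 by norm_num, ← mul_div_assoc, ← mul_div_assoc, ← add_div, this,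
      mul_comm (en n), mul_div_mul_left _ _ h1.ne']
  · simp only [w0, hn, if_false, en_succ, Nn_nonprime n hn]
    simp

lemma Ff_bound (b : ℕ → Bool) (n : ℕ) {M d t : ℝ} (hd : 0 < d) (hM : 0 < M) (h : Nn n b ≤ M) :
    ‖Ff b n (1/2 + d + t * Complex.I)‖ ^ 2 ≤
      ‖(1/2 + d + t * Complex.I : ℂ)‖ ^ 2 * (M / (2 * d)) := by
  set s : ℂ := 1/2 + d + t * Complex.I with hsdef
  have hre : s.re = 1/2 + d := by simp [hsdef]
  have hs : 0 < s.re := by rw [hre]; linarith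
  have hs0 : 0 < ‖s‖ := by
    rw [norm_pos_iff]; intro h; rw [h] at hs; simp at hs
  have hL := Sst_laplace b n hs
  set q := Real.sqrt (2 * d * M) with hq
  have hq0 : 0 < q := Real.sqrt_pos.2 (by positivity)
  have hq2 : q ^ 2 = 2 * d * M := Real.sq_sqrt (by positivity)
  have hI : Integrable ((Set.Ici (0:ℝ)).indicator (fun v => Real.exp (-((2*d) * v)))) :=
    (integrable_indicator_iff measurableSet_Ici).2 (expInt (by linarith))
  have hIv : ∫ v, ((Set.Ici (0:ℝ)).indicator (fun v => Real.exp (-((2*d) * v)))) v = 1/(2*d) := by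
    rw [integral_indicator measurableSet_Ici, integral_Ici_eq_integral_Ioi]
    have := integral_exp_mul_Ioi (a := -(2*d)) (by linarith) 0
    simp only [neg_mul] at this
    rw [this]; simp
  have hb : ‖Ff b n s / s‖ ≤ (1/(2*q)) * M + (q/2) * (1/(2*d)) := by
    rw [← hL]
    calc _ ≤ ∫ v, ((1/(2*q)) * ((Sst b n v) ^ 2 * Real.exp (-v)) +
          (q/2) * ((Set.Ici (0:ℝ)).indicator (fun v => Real.exp (-((2*d) * v)))) v) := by
          refine norm_integral_le_of_norm_le
            (((Sst_sq_int b n).const_mul _).add (hI.const_mul _))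
            (Filter.Eventually.of_forall fun v => ?_)
          rw [norm_mul, norm_exp_neg_mul, Complex.norm_real, hre, Real.norm_eq_abs]
          by_cases hv : 0 ≤ v
          · rw [Set.indicator_of_mem (Set.mem_Ici.2 hv)]
            have e1 : Real.exp (-v) = Real.exp (-(v/2)) ^ 2 := by
              rw [← Real.exp_nat_mul]; push_cast; ring_nf
            have e2 : Real.exp (-((2*d) * v)) = Real.exp (-(d*v)) ^ 2 := by
              rw [← Real.exp_nat_mul]; push_cast; ring_nf
            have e3 : Real.exp (-((1/2 + d) * v)) = Real.exp (-(v/2)) * Real.exp (-(d*v)) := by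
              rw [← Real.exp_add]; ring_nf
            rw [e1, e2, e3, ← sq_abs (Sst b n v)]
            set x := |Sst b n v|
            set y := Real.exp (-(v/2))
            set z := Real.exp (-(d*v))
            have := sq_nonneg (x * y - q * z)
            have e4 : 1/(2*q) * (x ^ 2 * y ^ 2) + q/2 * z ^ 2 - x * (y * z) =
              (1/(2*q)) * (x * y - q * z) ^ 2 := by field_simp; ring
            have : 0 ≤ (1/(2*q)) * (x * y - q * z) ^ 2 := by positivity
            linarith
          · rw [Set.indicator_of_notMem (by simpa using hv), Sst_neg b n v (not_le.1 hv)]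
            simp
      _ = (1/(2*q)) * Nn n b + (q/2) * (1/(2*d)) := by
          rw [integral_add ((Sst_sq_int b n).const_mul _) (hI.const_mul _), integral_const_mul,
            integral_const_mul, hIv]
          rfl
      _ ≤ _ := by gcongr
  have e5 : (1/(2*q)) * M + (q/2) * (1/(2*d)) = q / (2*d) := by
    have : M = q ^ 2 / (2 * d) := by rw [hq2]; field_simp
    rw [this]; field_simp; ring
  rw [e5, norm_div, div_le_iff₀ hs0] at hb
  calc ‖Ff b n s‖ ^ 2 ≤ (q / (2*d) * ‖s‖) ^ 2 := by gcongr
    _ = _ := by rw [mul_pow, div_pow, hq2]; field_simp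


def PS (n : ℕ) (g : ℕ → ℝ) : ℝ := ∑ i ∈ Finset.range n, (if i.Prime then g i else 0)

lemma PS_add (n : ℕ) (g h : ℕ → ℝ) : PS n (fun i => g i + h i) = PS n g + PS n h := by
  unfold PS
  rw [← Finset.sum_add_distrib]
  refine Finset.sum_congr rfl fun i _ => ?_
  split_ifs <;> simp

lemma PS_mul (n : ℕ) (c : ℝ) (g : ℕ → ℝ) : PS n (fun i => c * g i) = c * PS n g := by
  unfold PS
  rw [Finset.mul_sum]
  refine Finset.sum_congr rfl fun i _ => ?_
  split_ifs <;> simp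

lemma PS_sub (n : ℕ) (g h : ℕ → ℝ) : PS n (fun i => g i - h i) = PS n g - PS n h := by
  unfold PS
  rw [← Finset.sum_sub_distrib]
  refine Finset.sum_congr rfl fun i _ => ?_
  split_ifs <;> simp

lemma PS_mono {n : ℕ} {g h : ℕ → ℝ} (H : ∀ i < n, i.Prime → g i ≤ h i) : PS n g ≤ PS n h := by
  unfold PS
  refine Finset.sum_le_sum fun i hi => ?_
  split_ifs with hp
  · exact H i (Finset.mem_range.1 hi) hp
  · exact le_rfl

lemma PS_congr {n : ℕ} {g h : ℕ → ℝ} (H : ∀ i < n, i.Prime → g i = h i) : PS n g = PS n h :=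
  le_antisymm (PS_mono fun i hi hp => (H i hi hp).le) (PS_mono fun i hi hp => (H i hi hp).ge)

lemma PS_le_tsum (r : ℝ) (hr : r < -1) : ∃ C : ℝ, 0 ≤ C ∧ ∀ n, PS n (fun i => (i:ℝ) ^ r) ≤ C := by
  have hs : Summable (fun i : ℕ => (i:ℝ) ^ r) := Real.summable_nat_rpow.2 hr
  refine ⟨∑' i : ℕ, (i:ℝ) ^ r, tsum_nonneg fun i => by positivity, fun n => ?_⟩
  refine le_trans ?_ (hs.sum_le_tsum (Finset.range n) (fun i _ => by positivity))
  unfold PS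
  refine Finset.sum_le_sum fun i _ => ?_
  split_ifs
  · exact le_rfl
  · positivity

def dl (j : ℕ) : ℝ := (1/2) ^ j
def nn (j : ℕ) : ℕ := cut (dl j)
def Lam (t : ℝ) : ℝ := 1 + Real.log (2 + |t|)

lemma dl_pos (j : ℕ) : 0 < dl j := by unfold dl; positivity
lemma dl_le (j : ℕ) : dl j ≤ 1 := pow_le_one₀ (by norm_num) (by norm_num)
lemma log_dl (j : ℕ) : Real.log (1 / dl j) = j * Real.log 2 := by
  unfold dl
  rw [show (1 / (1/2 : ℝ) ^ j) = 2 ^ j by rw [one_div, one_div, inv_pow, inv_inv], Real.log_pow]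
lemma nn_mono : Monotone nn := by
  intro i j hij
  unfold nn cut
  have h : dl j ≤ dl i := pow_le_pow_of_le_one (by norm_num) (by norm_num) hij
  have := dl_pos j
  gcongr

lemma Lam_ge (t : ℝ) : 1 ≤ Lam t := by
  unfold Lam
  have : 0 ≤ Real.log (2 + |t|) := Real.log_nonneg (by linarith [abs_nonneg t])
  linarith

lemma n1 : ∃ C : ℝ, 0 ≤ C ∧ ∀ j, dl j * PS (nn j) (fun i => Real.log i / i) ≤ C := by
  obtain ⟨C, h0, h⟩ := log_div_prime_sum
  exact ⟨C, h0, fun j => h _ (dl_pos j) (dl_le j)⟩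

lemma n3 : ∃ C : ℝ, 0 ≤ C ∧ ∀ j : ℕ, |PS (nn j) (fun i => 1 / (i:ℝ)) - j * Real.log 2| ≤ C := by
  obtain ⟨C, h0, h⟩ := inv_prime_sum
  refine ⟨C, h0, fun j => ?_⟩
  rw [← log_dl]
  exact h _ (dl_pos j) (dl_le j)

lemma n4 : ∃ C : ℝ, 0 ≤ C ∧ ∀ (j : ℕ) (t : ℝ),
    -(C * Lam t) ≤ PS (nn j) (fun i => Real.cos (2 * t * Real.log i) / i) := by
  obtain ⟨C, h0, h⟩ := cos_prime_sum_ge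
  refine ⟨2 * C, by positivity, fun j t => le_trans ?_ (h _ (2 * t) (dl_pos j) (dl_le j))⟩
  have h1 : Real.log (2 + |2 * t|) ≤ Real.log 2 + Real.log (2 + |t|) := by
    rw [← Real.log_mul (by norm_num) (by positivity)]
    apply Real.log_le_log (by positivity)
    rw [abs_mul]; simp
    linarith
  have h2 : Real.log 2 ≤ 1 := by linarith [Real.log_two_lt_d9]
  have h3 : 1 + Real.log (2 + |2 * t|) ≤ 2 * Lam t := by
    have := Lam_ge t
    unfold Lam at *
    linarith
  nlinarith

/-- basic quantities -/
def rr (i : ℕ) : ℝ := (i:ℝ) ^ (-(1/2:ℝ))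
def cc (t : ℝ) (i : ℕ) : ℝ := Real.cos (t * Real.log i)
def aa (t : ℝ) (i : ℕ) : ℝ := if i.Prime then 2 * rr i * cc t i else 0
def qq (t : ℝ) (i : ℕ) : ℝ := if i.Prime then 2 * rr i * cc t i / (1 + 1 / (i:ℝ)) else 1

lemma rr_pos {i : ℕ} (hi : i.Prime) : 0 < rr i := by
  have : (0:ℝ) < i := by exact_mod_cast hi.pos
  unfold rr; positivity

lemma rr_sq {i : ℕ} (hi : i.Prime) : rr i ^ 2 = 1 / (i:ℝ) := by
  have : (0:ℝ) < i := by exact_mod_cast hi.pos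
  unfold rr
  rw [← Real.rpow_natCast, ← Real.rpow_mul this.le]
  norm_num
  rw [Real.rpow_neg_one]

lemma inv_le_half {i : ℕ} (hi : i.Prime) : 1 / (i:ℝ) ≤ 1/2 := by
  have : (2:ℝ) ≤ i := by exact_mod_cast hi.two_le
  gcongr

lemma inv_pos' {i : ℕ} (hi : i.Prime) : 0 < 1 / (i:ℝ) := by
  have : (0:ℝ) < i := by exact_mod_cast hi.pos
  positivity

lemma cc_sq_le (t : ℝ) (i : ℕ) : cc t i ^ 2 ≤ 1 := by
  unfold cc; exact Real.cos_sq_le_one _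

lemma cc_double (t : ℝ) (i : ℕ) : 4 * cc t i ^ 2 = 2 + 2 * Real.cos (2 * t * Real.log i) := by
  unfold cc
  rw [mul_assoc 2 t, Real.cos_two_mul]; ring

lemma aa_sq {t : ℝ} {i : ℕ} (hi : i.Prime) : aa t i ^ 2 = 4 * cc t i ^ 2 * (1 / (i:ℝ)) := by
  simp only [aa, hi, if_true]
  rw [← rr_sq hi]; ring

lemma aa_sq_le (t : ℝ) (i : ℕ) : aa t i ^ 2 ≤ 2 := by
  by_cases hi : i.Prime
  · rw [aa_sq hi]
    nlinarith [cc_sq_le t i, inv_le_half hi, inv_pos' hi, sq_nonneg (cc t i)]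
  · simp [aa, hi]

lemma aa_abs_le (t : ℝ) (i : ℕ) : |aa t i| ≤ 3/2 :=
  abs_le_of_sq_le_sq (by nlinarith [aa_sq_le t i]) (by norm_num)

lemma qq_sq_le (t : ℝ) (i : ℕ) : qq t i ^ 2 ≤ 1 := by
  by_cases hi : i.Prime
  · simp only [qq, hi, if_true]
    have h1 := rr_sq hi
    have h2 := cc_sq_le t i
    rw [← h1, div_pow, div_le_one (by positivity)]
    have : (2 * rr i * cc t i) ^ 2 ≤ (2 * rr i) ^ 2 := by
      rw [mul_pow]; nlinarith [sq_nonneg (2 * rr i)]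
    nlinarith [sq_nonneg (1 - rr i ^ 2)]
  · simp [qq, hi]

lemma qq_sq_le' {t : ℝ} {i : ℕ} (hi : i.Prime) : qq t i ^ 2 ≤ 4 * (1 / (i:ℝ)) := by
  simp only [qq, hi, if_true]
  have h1 := rr_sq hi
  have h2 := cc_sq_le t i
  have h3 := inv_pos' hi
  rw [div_pow]
  have e : (2 * rr i * cc t i) ^ 2 ≤ 4 * (1 / (i:ℝ)) := by
    rw [← h1, mul_pow]; nlinarith [sq_nonneg (2 * rr i)]
  refine le_trans (div_le_self (sq_nonneg _) ?_) e
  nlinarith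

lemma aa_qq_ge {t : ℝ} {i : ℕ} (hi : i.Prime) :
    4 * cc t i ^ 2 * (1 / (i:ℝ)) - 4 * (i:ℝ) ^ (-2:ℝ) ≤ aa t i * qq t i := by
  have h2 := cc_sq_le t i
  have h3 := inv_pos' hi
  have e2 : (i:ℝ) ^ (-2:ℝ) = (1 / (i:ℝ)) ^ 2 := by
    rw [Real.rpow_neg (by positivity)]; norm_num
  have e : aa t i * qq t i = 4 * cc t i ^ 2 * (1 / (i:ℝ)) / (1 + 1 / (i:ℝ)) := by
    rw [← aa_sq hi]; simp only [aa, qq, hi, if_true]; ring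
  rw [e, e2]
  set x := 1 / (i:ℝ)
  rw [le_div_iff₀ (by linarith)]
  have := sq_nonneg (cc t i)
  nlinarith [mul_pos h3 h3, mul_pos (mul_pos h3 h3) h3]

lemma aa_qq_nonneg {t : ℝ} {i : ℕ} (hi : i.Prime) :
    0 ≤ aa t i * qq t i ∧ aa t i * qq t i ≤ 4 * (1 / (i:ℝ)) := by
  have h2 := cc_sq_le t i
  have h3 := inv_pos' hi
  have e : aa t i * qq t i = 4 * cc t i ^ 2 * (1 / (i:ℝ)) / (1 + 1 / (i:ℝ)) := by
    rw [← aa_sq hi]; simp only [aa, qq, hi, if_true]; ring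
  rw [e]
  refine ⟨by positivity, (div_le_self (by positivity) (by linarith)).trans ?_⟩
  have := sq_nonneg (cc t i)
  nlinarith

/-- smoothing weight `i^{-δ}` -/
lemma smooth_bounds {i : ℕ} (hi : i.Prime) {d : ℝ} (hd : 0 ≤ d) :
    0 ≤ (i:ℝ) ^ (-d) ∧ (i:ℝ) ^ (-d) ≤ 1 ∧ 1 - (i:ℝ) ^ (-d) ≤ d * Real.log i := by
  have h0 : (0:ℝ) < i := by exact_mod_cast hi.pos
  have h1 : (1:ℝ) ≤ i := by exact_mod_cast hi.one_lt.le
  refine ⟨by positivity, Real.rpow_le_one_of_one_le_of_nonpos h1 (by linarith), ?_⟩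
  rw [Real.rpow_def_of_pos h0]
  linarith [Real.add_one_le_exp (Real.log i * -d)]

def LL (t : ℝ) (j : ℕ) (b : ℕ → Bool) : ℝ :=
  ∑ i ∈ Finset.range (nn j), aa t i * (i:ℝ) ^ (-(dl j)) * sg (b i)

def Bd (CB A t : ℝ) (j : ℕ) : ℝ :=
  2 * j * Real.log 2 + Real.log A + 2 * Real.log (2 + |t|) + CB +
    PS (nn j) (fun i => Real.cos (2 * t * Real.log i) / i)

lemma LL_dep (t : ℝ) (j : ℕ) : Dep (nn j) (LL t j) := fun b b' hb => by
  unfold LL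
  refine Finset.sum_congr rfl fun i hi => ?_
  rw [hb i (Finset.mem_range.1 hi)]

def oo (t : ℝ) (i : ℕ) : Bool := decide (0 ≤ aa t i)

lemma oo_spec (t : ℝ) (i : ℕ) : 0 ≤ aa t i * sg (oo t i) := by
  unfold oo
  by_cases h : 0 ≤ aa t i
  · simp [h]
  · simp [h]; linarith

lemma oo_spec' (t : ℝ) (i : ℕ) : aa t i * sg (!oo t i) ≤ 0 := by
  unfold oo
  by_cases h : 0 ≤ aa t i
  · simp [h]
  · simp [h]; linarith

lemma LL_oo (t : ℝ) (j : ℕ) (b : ℕ → Bool) (i : ℕ) :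
    LL t j (Function.update b i (!oo t i)) ≤ LL t j (Function.update b i (oo t i)) := by
  unfold LL
  refine Finset.sum_le_sum fun k hk => ?_
  by_cases hki : k = i
  · subst hki
    simp only [Function.update_self]
    have h0 : 0 ≤ (k:ℝ) ^ (-(dl j)) := by positivity
    have h1 := oo_spec t k
    have h2 := oo_spec' t k
    nlinarith
  · simp [Function.update_of_ne hki]


def rho (t : ℝ) (j i : ℕ) : ℝ :=
  if i < nn j then aa t i * (1 - (i:ℝ) ^ (-(dl j))) else aa t i

def RR (t : ℝ) : ℕ → (ℕ → Bool) → ℝ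
  | 0, _ => 0
  | j + 1, b => walk (rho t j) (qq t) (nn (j + 1)) b

lemma sum_eq_PS (n : ℕ) (g : ℕ → ℝ) (h : ∀ i, ¬ i.Prime → g i = 0) :
    ∑ i ∈ Finset.range n, g i = PS n g := by
  unfold PS
  refine Finset.sum_congr rfl fun i _ => ?_
  split_ifs with hp
  · rfl
  · exact h i hp

lemma rho_abs_le (t : ℝ) (j i : ℕ) : |rho t j i| ≤ |aa t i| := by
  unfold rho
  split_ifs
  · by_cases hi : i.Prime
    · obtain ⟨h0, h1, _⟩ := smooth_bounds hi (dl_pos j).le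
      rw [abs_mul, abs_of_nonneg (by linarith : 0 ≤ 1 - (i:ℝ) ^ (-(dl j)))]
      nlinarith [abs_nonneg (aa t i)]
    · simp [aa, hi]
  · exact le_rfl

lemma rho_sq_sum : ∃ C : ℝ, 0 ≤ C ∧ ∀ t j,
    ∑ i ∈ Finset.range (nn (j+1)), rho t j i ^ 2 ≤ C := by
  obtain ⟨C1, hC10, hC1⟩ := n1
  obtain ⟨C3, hC30, hC3⟩ := n3
  refine ⟨4 * C1 + 4 * (Real.log 2 + 2 * C3), by positivity, fun t j => ?_⟩
  have hsplit : ∑ i ∈ Finset.range (nn (j+1)), rho t j i ^ 2 ≤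
      PS (nn j) (fun i => 4 * (dl j * (Real.log i / i)) - 4 * (1 / (i:ℝ))) +
        PS (nn (j+1)) (fun i => 4 * (1 / (i:ℝ))) := by
    rw [← Finset.sum_range_add_sum_Ico _ (nn_mono (Nat.le_succ j))]
    unfold PS
    rw [← Finset.sum_range_add_sum_Ico (fun i : ℕ => if i.Prime then 4 * (1 / (i:ℝ)) else 0)
      (nn_mono (Nat.le_succ j)), ← add_assoc, ← Finset.sum_add_distrib]
    refine add_le_add (Finset.sum_le_sum fun i hi => ?_) (Finset.sum_le_sum fun i hi => ?_)
    · by_cases hp : i.Prime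
      · simp only [hp, if_true, sub_add_cancel]
        obtain ⟨h0, h1, h2⟩ := smooth_bounds hp (dl_pos j).le
        simp only [rho, Finset.mem_range.1 hi, if_true]
        rw [mul_pow, aa_sq hp]
        have h3 := inv_pos' hp
        have h4 := cc_sq_le t i
        have h5 : (1 - (i:ℝ) ^ (-(dl j))) ^ 2 ≤ dl j * Real.log i := by nlinarith
        calc 4 * cc t i ^ 2 * (1 / (i:ℝ)) * (1 - (i:ℝ) ^ (-(dl j))) ^ 2
            ≤ 4 * 1 * (1 / (i:ℝ)) * (dl j * Real.log i) := by gcongr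
          _ = _ := by ring
      · simp [hp, rho, aa]
    · by_cases hp : i.Prime
      · simp only [hp, if_true]
        have : ¬ i < nn j := by have := (Finset.mem_Ico.1 hi).1; omega
        simp only [rho, this, if_false]
        rw [aa_sq hp]
        have h3 := inv_pos' hp
        have h4 := cc_sq_le t i
        nlinarith
      · simp [hp, rho, aa]
  refine hsplit.trans ?_
  rw [PS_sub, PS_mul, PS_mul, PS_mul, PS_mul]
  have h1 := hC1 j
  have h2 := (abs_le.1 (hC3 j)).1
  have h3 := (abs_le.1 (hC3 (j+1))).2
  push_cast at h3
  linarith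

lemma drift : ∃ C : ℝ, 0 ≤ C ∧ ∀ t j,
    2 * (j * Real.log 2) + 2 * PS (nn j) (fun i => Real.cos (2 * t * Real.log i) / i) - C ≤
    ∑ i ∈ Finset.range (nn j), aa t i * (i:ℝ) ^ (-(dl j)) * qq t i := by
  obtain ⟨C1, hC10, hC1⟩ := n1
  obtain ⟨C2, hC20, hC2⟩ := PS_le_tsum (-2) (by norm_num)
  obtain ⟨C3, hC30, hC3⟩ := n3
  refine ⟨2 * C3 + 4 * C2 + 4 * C1, by positivity, fun t j => ?_⟩
  rw [sum_eq_PS _ _ (fun i hi => by simp [aa, hi])]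
  have key : PS (nn j) (fun i => 2 * (1 / (i:ℝ)) + 2 * (Real.cos (2 * t * Real.log i) / i) -
      4 * (i:ℝ) ^ (-2:ℝ) - 4 * (dl j * (Real.log i / i))) ≤
      PS (nn j) (fun i => aa t i * (i:ℝ) ^ (-(dl j)) * qq t i) := by
    refine PS_mono fun i _ hp => ?_
    obtain ⟨h0, h1, h2⟩ := smooth_bounds hp (dl_pos j).le
    have h3 := aa_qq_ge (t := t) hp
    obtain ⟨h4, h5⟩ := aa_qq_nonneg (t := t) hp
    have h6 := cc_double t i
    have h7 : aa t i * qq t i * (1 - (i:ℝ) ^ (-(dl j))) ≤ 4 * (1 / (i:ℝ)) * (dl j * Real.log i) := by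
      gcongr
    have e : 4 * (1 / (i:ℝ)) * (dl j * Real.log i) = 4 * (dl j * (Real.log i / i)) := by ring
    have e2 : 4 * cc t i ^ 2 * (1 / (i:ℝ)) =
      2 * (1 / (i:ℝ)) + 2 * (Real.cos (2 * t * Real.log i) / i) := by rw [h6]; ring
    rw [e] at h7
    rw [e2] at h3
    linarith
  refine le_trans ?_ key
  rw [PS_sub, PS_sub, PS_add, PS_mul, PS_mul, PS_mul, PS_mul, PS_mul]
  have h1 := hC1 j
  have h2 := (abs_le.1 (hC3 j)).1
  have h3 := hC2 (nn j)
  linarith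

lemma variance_lower : ∃ C : ℝ, 0 ≤ C ∧ ∀ t j,
    2 * (j * Real.log 2) - C * Lam t ≤
    ∑ i ∈ Finset.range (nn j), aa t i ^ 2 * (1 - qq t i ^ 2) := by
  obtain ⟨C2, hC20, hC2⟩ := PS_le_tsum (-2) (by norm_num)
  obtain ⟨C3, hC30, hC3⟩ := n3
  obtain ⟨C4, hC40, hC4⟩ := n4
  refine ⟨2 * C3 + 16 * C2 + 2 * C4, by positivity, fun t j => ?_⟩
  rw [sum_eq_PS _ _ (fun i hi => by simp [aa, hi])]
  have key : PS (nn j) (fun i => 2 * (1 / (i:ℝ)) + 2 * (Real.cos (2 * t * Real.log i) / i) -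
      16 * (i:ℝ) ^ (-2:ℝ)) ≤
      PS (nn j) (fun i => aa t i ^ 2 * (1 - qq t i ^ 2)) := by
    refine PS_mono fun i _ hp => ?_
    have h3 := qq_sq_le' (t := t) hp
    have h6 := cc_double t i
    have h4 := cc_sq_le t i
    have h5 := inv_pos' hp
    have e2 : (i:ℝ) ^ (-2:ℝ) = (1 / (i:ℝ)) ^ 2 := by
      rw [Real.rpow_neg (by positivity)]; norm_num
    have e3 : 4 * cc t i ^ 2 * (1 / (i:ℝ)) =
      2 * (1 / (i:ℝ)) + 2 * (Real.cos (2 * t * Real.log i) / i) := by rw [h6]; ring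
    have h7 : aa t i ^ 2 * qq t i ^ 2 ≤ 16 * (1 / (i:ℝ)) ^ 2 := by
      rw [aa_sq hp]
      calc 4 * cc t i ^ 2 * (1 / (i:ℝ)) * qq t i ^ 2 ≤ 4 * 1 * (1 / (i:ℝ)) * (4 * (1 / (i:ℝ))) := by
            gcongr
        _ = _ := by ring
    rw [e2, ← e3, ← aa_sq hp]
    linarith
  refine le_trans ?_ key
  rw [PS_sub, PS_add, PS_mul, PS_mul, PS_mul]
  have h2 := (abs_le.1 (hC3 j)).1
  have h3 := hC2 (nn j)
  have h4 := hC4 j t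
  have h5 := Lam_ge t
  nlinarith

lemma walk_decomp (t : ℝ) (j : ℕ) (b : ℕ → Bool) :
    walk (aa t) (qq t) (nn (j+1)) b = RR t (j+1) b + (LL t j b -
      ∑ i ∈ Finset.range (nn j), aa t i * (i:ℝ) ^ (-(dl j)) * qq t i) := by
  simp only [RR, walk, LL]
  rw [← Finset.sum_sub_distrib, ← sub_eq_iff_eq_add', ← Finset.sum_sub_distrib,
    ← Finset.sum_range_add_sum_Ico _ (nn_mono (Nat.le_succ j)),
    Finset.sum_eq_zero (s := Finset.Ico _ _), add_zero]
  · refine Finset.sum_congr rfl fun i hi => ?_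
    simp only [rho, Finset.mem_range.1 hi, if_true]
    ring
  · intro i hi
    have : ¬ i < nn j := by have := (Finset.mem_Ico.1 hi).1; omega
    simp [rho, this]

lemma nn_zero : nn 0 = 3 := by
  unfold nn cut dl
  have : ⌊Real.exp (1 / (1/2) ^ 0)⌋₊ = 2 := by
    rw [Nat.floor_eq_iff (Real.exp_pos _).le]
    have h1 := Real.exp_one_gt_d9
    have h2 := Real.exp_one_lt_d9
    norm_num
    constructor <;> linarith
  rw [this]

lemma walk_zero_le (t : ℝ) (b : ℕ → Bool) : walk (aa t) (qq t) (nn 0) b ≤ 9 := by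
  rw [nn_zero]
  unfold walk
  have h : ∀ i, aa t i * (sg (b i) - qq t i) ≤ 3 := by
    intro i
    have h1 := aa_abs_le t i
    have h2 : |sg (b i) - qq t i| ≤ 2 := by
      refine (abs_sub _ _).trans ?_
      have := abs_le_of_sq_le_sq (a := qq t i) (b := 1) (by simpa using qq_sq_le t i) zero_le_one
      rw [abs_sg]; linarith [abs_le.2 (abs_le.1 this)]
    calc _ ≤ |aa t i * (sg (b i) - qq t i)| := le_abs_self _
      _ = |aa t i| * |sg (b i) - qq t i| := abs_mul _ _
      _ ≤ 3/2 * 2 := by gcongr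
      _ = 3 := by norm_num
  calc _ ≤ ∑ i ∈ Finset.range 3, (3:ℝ) := Finset.sum_le_sum fun i _ => h i
    _ = 9 := by norm_num

lemma domination (CB : ℝ) (hCB : 0 ≤ CB) : ∃ C : ℝ, 0 ≤ C ∧ ∀ A t : ℝ, 1 ≤ A → ∀ j b,
    (∀ i < j, LL t i b ≤ Bd CB A t i) →
    walk (aa t) (qq t) (nn j) b ≤ (Real.log A + C * Lam t) + RR t j b := by
  obtain ⟨C1, hC10, hC1⟩ := drift
  obtain ⟨C4, hC40, hC4⟩ := n4
  refine ⟨9 + 2 + CB + C1 + C4, by positivity, fun A t hA j b hb => ?_⟩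
  have hL := Lam_ge t
  have hlogA := Real.log_nonneg hA
  cases j with
  | zero =>
    have := walk_zero_le t b
    simp only [RR, add_zero]
    have : 9 * Lam t ≤ (9 + 2 + CB + C1 + C4) * Lam t := by gcongr; linarith
    linarith
  | succ j =>
    rw [walk_decomp]
    have h1 := hb j (by omega)
    have h2 := hC1 t j
    have h3 := hC4 j t
    unfold Bd at h1
    have e : Real.log (2 + |t|) = Lam t - 1 := by unfold Lam; ring
    rw [e] at h1
    nlinarith


lemma RR_exp : ∃ D : ℝ, 0 ≤ D ∧ ∀ (t : ℝ) (N j : ℕ), nn j ≤ N →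
    Ex (wq (qq t)) N (fun b => Real.exp (RR t j b)) ≤ D := by
  obtain ⟨C, hC0, hC⟩ := rho_sq_sum
  refine ⟨Real.exp (10 * C), (Real.exp_pos _).le, fun t N j hj => ?_⟩
  cases j with
  | zero =>
    simp only [RR, Real.exp_zero]
    rw [Ex_const]
    exact Real.one_le_exp (by positivity)
  | succ j =>
    simp only [RR]
    rw [Ex_stable (wq (qq t)) hj ((dep_walk (rho t j) (qq t) (nn (j+1))).comp Real.exp)]
    refine (Ex_walk_exp (qq_sq_le t) (fun i => (rho_abs_le t j i).trans (aa_abs_le t i)) _).trans ?_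
    exact Real.exp_le_exp.2 (by linarith [hC t j])

theorem ballot (CB : ℝ) (hCB : 0 ≤ CB) : ∃ C : ℝ, 0 ≤ C ∧ ∀ A t : ℝ, 1 ≤ A → ∀ K N : ℕ, 1 ≤ K →
    nn K ≤ N → Ex (wq (qq t)) N (surv (LL t) (Bd CB A t) K) ≤ C * (Real.log A + Lam t) / √K := by
  obtain ⟨C1, hC10, hC1⟩ := domination CB hCB
  obtain ⟨D, hD0, hD⟩ := RR_exp
  obtain ⟨C3, hC30, hC3⟩ := variance_lower
  set c1 : ℝ := 3 / (8 * √(3 + 8)) with hc1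
  have hs : (1:ℝ) ≤ √(3 + 8) := Real.one_le_sqrt.2 (by norm_num)
  have hc1p : 0 < c1 := by positivity
  have hc1le : c1 ≤ 1 := by
    rw [hc1, div_le_one (by positivity)]; linarith
  obtain ⟨Cb, hCb, hb⟩ := bootstrap c1 hc1p
  set C5 : ℝ := C1 + 2 * D + 3 * C3 + 1 with hC5
  have hC51 : 1 ≤ C5 := by rw [hC5]; nlinarith
  refine ⟨Cb * C5, by positivity, fun A t hA K N hK hN => ?_⟩
  have hA0 : 0 ≤ Real.log A := Real.log_nonneg hA
  have hLam := Lam_ge t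
  have hw0 := wq_nonneg (qq_sq_le t)
  have hw1 := wq_le_one (qq_sq_le t)
  have hu0 : ∀ j, 0 ≤ Ex (wq (qq t)) N (surv (LL t) (Bd CB A t) j) := fun j =>
    Ex_nonneg hw0 hw1 N (fun b => surv_nonneg j b)
  have hu1 : ∀ j, Ex (wq (qq t)) N (surv (LL t) (Bd CB A t) j) ≤ 1 := fun j => by
    have := Ex_mono hw0 hw1 N (g := surv (LL t) (Bd CB A t) j) (h := fun _ => 1)
      (fun b => surv_le_one j b)
    rwa [Ex_const] at this
  have main := hb (fun j => Ex (wq (qq t)) N (surv (LL t) (Bd CB A t) j))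
    (Real.log A + C5 * Lam t) K (by nlinarith) hu0 hu1 ?_ K hK le_rfl
  · refine main.trans ?_
    rw [mul_assoc]
    gcongr
    nlinarith
  intro J hJ1 hJK
  have hJr : (1:ℝ) ≤ J := by exact_mod_cast hJ1
  set S := ∑ j ∈ Finset.range J, 2 / ((j : ℝ) + 1) *
    Ex (wq (qq t)) N (surv (LL t) (Bd CB A t) (j + 1)) with hS
  have hS0 : 0 ≤ S := Finset.sum_nonneg fun j _ => mul_nonneg (by positivity) (hu0 _)
  have hsJ : √(J:ℝ) ≤ J := by
    rw [Real.sqrt_le_left (by linarith)]; nlinarith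
  by_cases hcase : C3 * Lam t ≤ 0.38 * J
  · have hstep := ballot_step (aa t) (qq t) (qq_sq_le t) (oo t) (oo_spec t) nn nn_mono (LL t)
      (Bd CB A t) (LL_dep t) (LL_oo t) (RR t) D (Real.log A + C1 * Lam t) (by positivity) N J
      ((nn_mono hJK).trans hN) (fun j hj => hD t N j ((nn_mono (hj.trans hJK)).trans hN))
      (fun j _ b => hC1 A t hA j b)
    have hV := hC3 t J
    have hl2 := Real.log_two_gt_d9
    have hVJ : (J:ℝ) ≤ ∑ i ∈ Finset.range (nn J), aa t i ^ 2 * (1 - qq t i ^ 2) := by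
      nlinarith
    have hneg := Ex_walk_neg (a := aa t) (qq_sq_le t) 8 (by norm_num)
      (fun i => by linarith [aa_sq_le t i]) (nn J) (by linarith)
    have h2 : c1 * √J ≤ Ex (wq (qq t)) (nn J) (fun b => max (-walk (aa t) (qq t) (nn J) b) 0) := by
      refine le_trans ?_ hneg
      gcongr
    have h3 := mul_le_mul_of_nonneg_right h2 (hu0 J)
    rw [mul_comm (Ex _ (nn J) _)] at h3
    refine (h3.trans hstep).trans ?_
    have : C1 * Lam t + 2 * D ≤ C5 * Lam t := by rw [hC5]; nlinarith
    linarith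
  · push Not at hcase
    have h1 : c1 * √J * Ex (wq (qq t)) N (surv (LL t) (Bd CB A t) J) ≤ 1 * J * 1 := by
      have := hu0 J
      have := hu1 J
      gcongr
    have : 3 * C3 * Lam t ≤ C5 * Lam t := by rw [hC5]; nlinarith
    show c1 * √J * Ex (wq (qq t)) N (surv (LL t) (Bd CB A t) J) ≤ _
    nlinarith


lemma log_norm_lower {z : ℂ} (hz : ‖z‖ ^ 2 ≤ 1/2) :
    2 * z.re - (z ^ 2).re - 3 * ‖z‖ ^ 3 ≤ Real.log (‖1 + z‖ ^ 2) ∧ 1 + z ≠ 0 := by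
  have hn := norm_nonneg z
  have h1 : ‖z‖ ≤ 0.75 := abs_le_of_sq_le_sq' (by norm_num; linarith) (by norm_num) |>.2
  have hlt : ‖z‖ < 1 := by linarith
  constructor
  · have h := Complex.norm_log_sub_logTaylor_le 2 hlt
    have e : Complex.logTaylor (2 + 1) z = z - z ^ 2 / 2 := by
      simp [Complex.logTaylor_succ, Complex.logTaylor_zero]; ring
    rw [e] at h
    have h2 := (Complex.abs_re_le_norm _).trans h
    have e2 : (Complex.log (1 + z) - (z - z ^ 2 / 2)).re = Real.log ‖1 + z‖ - (z.re - (z^2).re / 2) := by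
      simp [Complex.log_re]
    rw [e2] at h2
    have h3 : ‖z‖ ^ (2+1) * (1 - ‖z‖)⁻¹ / ((2:ℕ) + 1) ≤ ‖z‖ ^ 3 * 4 / 3 := by
      have : (1 - ‖z‖)⁻¹ ≤ 4 := by
        rw [inv_le_comm₀ (by linarith) (by norm_num)]; norm_num; linarith
      have h4 : ((2:ℕ):ℝ) + 1 = 3 := by norm_num
      rw [h4]
      gcongr
    rw [Real.log_pow]
    have := (abs_le.1 (h2.trans h3)).1
    have h5 : 0 ≤ ‖z‖ ^ 3 := by positivity
    push_cast
    linarith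
  · intro h0
    have : z = -1 := by linear_combination h0
    rw [this] at hlt; simp at hlt

lemma factor_lower {i : ℕ} (hi : i.Prime) {d t : ℝ} (hd : 0 < d) (x : Bool) :
    aa t i * (i:ℝ) ^ (-d) * sg x - (Real.cos (2 * t * Real.log i) / i) -
      2 * (d * (Real.log i / i)) - 3 * (i:ℝ) ^ (-(3/2):ℝ) ≤
      Real.log (‖1 + (sg x : ℂ) * (i:ℂ) ^ (-(1/2 + d + t * Complex.I : ℂ))‖ ^ 2) ∧
      1 + (sg x : ℂ) * (i:ℂ) ^ (-(1/2 + d + t * Complex.I : ℂ)) ≠ 0 := by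
  have hi0 : (0:ℝ) < i := by exact_mod_cast hi.pos
  have hi2 : (2:ℝ) ≤ i := by exact_mod_cast hi.two_le
  have hic : (i:ℂ) ≠ 0 := by exact_mod_cast hi.ne_zero
  set y : ℂ := (i:ℂ) ^ (-(1/2 + d + t * Complex.I : ℂ)) with hy
  have hyre : y.re = (i:ℝ) ^ (-(1/2 + d)) * Real.cos (t * Real.log i) := by
    rw [← prime_cpow_re i hi.pos (1/2 + d) t, hy]; push_cast; rfl
  have hy2 : (y ^ 2).re = (i:ℝ) ^ (-(1 + 2 * d)) * Real.cos (2 * t * Real.log i) := by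
    rw [← prime_cpow_re i hi.pos (1 + 2 * d) (2 * t), hy, ← Complex.cpow_nat_mul]
    congr 2; push_cast; ring
  have hyn : ‖y‖ = (i:ℝ) ^ (-(1/2 + d)) := by
    rw [hy, Complex.norm_natCast_cpow_of_pos hi.pos]
    simp
  have hsg2 : (sg x : ℂ) ^ 2 = 1 := by cases x <;> simp
  have hz : ‖(sg x : ℂ) * y‖ = ‖y‖ := by
    rw [norm_mul, Complex.norm_real, Real.norm_eq_abs, abs_sg, one_mul]
  have hyr : ‖y‖ ≤ rr i := by
    rw [hyn]; unfold rr
    exact Real.rpow_le_rpow_of_exponent_le (by linarith) (by linarith)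
  have hr2 := rr_sq hi
  have hh := inv_le_half hi
  have hy0 := norm_nonneg y
  obtain ⟨h1, h2⟩ := log_norm_lower (z := (sg x : ℂ) * y) (by rw [hz]; nlinarith)
  refine ⟨le_trans ?_ h1, h2⟩
  rw [hz, mul_pow, hsg2, one_mul, hy2, Complex.re_ofReal_mul, hyre]
  have hr3 : ‖y‖ ^ 3 ≤ (i:ℝ) ^ (-(3/2):ℝ) := by
    have : (i:ℝ) ^ (-(3/2):ℝ) = rr i ^ 3 := by
      unfold rr
      rw [← Real.rpow_natCast, ← Real.rpow_mul hi0.le]; norm_num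
    rw [this]; gcongr
  have e1 : (i:ℝ) ^ (-(1/2 + d)) = rr i * (i:ℝ) ^ (-d) := by
    unfold rr; rw [← Real.rpow_add hi0]; congr 1; ring
  have e2 : (i:ℝ) ^ (-(1 + 2 * d)) = (1 / (i:ℝ)) * (i:ℝ) ^ (-(2 * d)) := by
    rw [one_div, ← Real.rpow_neg_one, ← Real.rpow_add hi0]; congr 1; ring
  obtain ⟨g0, g1, g2⟩ := smooth_bounds hi (d := 2 * d) (by linarith)
  rw [e1, e2]
  simp only [aa, hi, if_true, cc]
  have hc := Real.abs_cos_le_one (2 * t * Real.log i)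
  have key : (1 / (i:ℝ)) * (i:ℝ) ^ (-(2 * d)) * Real.cos (2 * t * Real.log i) ≤
      Real.cos (2 * t * Real.log i) / i + 2 * (d * (Real.log i / i)) := by
    set c := Real.cos (2 * t * Real.log i)
    set u := (i:ℝ) ^ (-(2 * d))
    have h3 : -(c * (1 - u)) ≤ 1 - u := by nlinarith [(abs_le.1 hc).1]
    have h4 : -(c * (1 - u)) ≤ 2 * d * Real.log i := h3.trans g2
    have : 0 ≤ (2 * d * Real.log i + c * (1 - u)) / i := div_nonneg (by linarith) hi0.le
    have e : Real.cos (2 * t * Real.log i) / i + 2 * (d * (Real.log i / i)) - 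
      (1 / (i:ℝ)) * u * c = (2 * d * Real.log i + c * (1 - u)) / i := by field_simp; ring
    linarith
  linarith

lemma log_en_le (n : ℕ) : Real.log (en n) ≤ PS n (fun i => 1 / (i:ℝ)) := by
  unfold en PS
  rw [Real.log_prod (fun i _ => by split_ifs <;> positivity)]
  refine Finset.sum_le_sum fun i _ => ?_
  split_ifs
  · have := Real.log_le_sub_one_of_pos (x := 1 + 1 / (i:ℝ)) (by positivity)
    linarith
  · simp

theorem barrier : ∃ CB : ℝ, 0 ≤ CB ∧ ∀ (A t : ℝ), 1 ≤ A → ∀ (b : ℕ → Bool) (j : ℕ),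
    Nn (nn j) b / en (nn j) ≤ A → LL t j b ≤ Bd CB A t j := by
  obtain ⟨C1, hC10, hC1⟩ := n1
  obtain ⟨C2, hC20, hC2⟩ := PS_le_tsum (-(3/2)) (by norm_num)
  obtain ⟨C3, hC30, hC3⟩ := n3
  refine ⟨C3 + 2 * C1 + 3 * C2, by positivity, fun A t hA b j h => ?_⟩
  have hen := en_pos (nn j)
  rw [div_le_iff₀ hen] at h
  have hd := dl_pos j
  have hd1 := dl_le j
  have hF := Ff_bound b (nn j) (t := t) hd (by positivity) h
  have hlow : LL t j b - PS (nn j) (fun i => Real.cos (2 * t * Real.log i) / i) -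
      2 * (dl j * PS (nn j) (fun i => Real.log i / i)) - 3 * PS (nn j) (fun i => (i:ℝ) ^ (-(3/2):ℝ)) ≤
      Real.log (‖Ff b (nn j) (1/2 + dl j + t * Complex.I)‖ ^ 2) ∧
      Ff b (nn j) (1/2 + dl j + t * Complex.I) ≠ 0 := by
    constructor
    · unfold Ff
      rw [norm_prod, ← Finset.prod_pow, Real.log_prod]
      · unfold LL
        rw [sum_eq_PS _ _ (fun i hi => by simp [aa, hi]), ← PS_mul, ← PS_mul, ← PS_mul, ← PS_sub,
          ← PS_sub, ← PS_sub]
        unfold PS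
        refine Finset.sum_le_sum fun i _ => ?_
        split_ifs with hp
        · exact (factor_lower hp hd (b i)).1
        · simp
      · intro i _
        split_ifs with hp
        · have := (factor_lower hp (t := t) hd (b i)).2
          exact pow_ne_zero 2 (norm_ne_zero_iff.2 this)
        · simp
    · unfold Ff
      refine Finset.prod_ne_zero_iff.2 fun i _ => ?_
      split_ifs with hp
      · exact (factor_lower hp (t := t) hd (b i)).2
      · simp
  obtain ⟨hlow, hne⟩ := hlow
  have hs : ‖(1/2 + dl j + t * Complex.I : ℂ)‖ ≤ 2 + |t| := by
    have e : (1/2 + dl j + t * Complex.I : ℂ) = ((1/2 + dl j : ℝ) : ℂ) + t * Complex.I := by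
      push_cast; ring
    rw [e]
    refine (norm_add_le _ _).trans ?_
    rw [norm_mul, Complex.norm_real, Complex.norm_real, Complex.norm_I, Real.norm_eq_abs,
      Real.norm_eq_abs, abs_of_pos (by linarith)]
    linarith
  have hup : Real.log (‖Ff b (nn j) (1/2 + dl j + t * Complex.I)‖ ^ 2) ≤
      2 * Real.log (2 + |t|) + (Real.log A + Real.log (en (nn j)) + Real.log (1 / dl j)) := by
    have ht := abs_nonneg t
    have : Real.log ((2 + |t|) ^ 2 * (A * en (nn j) * (1 / dl j))) =
      2 * Real.log (2 + |t|) + (Real.log A + Real.log (en (nn j)) + Real.log (1 / dl j)) := by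
      rw [Real.log_mul (by positivity) (by positivity), Real.log_mul (by positivity) (by positivity),
        Real.log_mul (by positivity) (by positivity), Real.log_pow]
      norm_num
    rw [← this]
    refine Real.log_le_log (by positivity) (hF.trans ?_)
    gcongr
    rw [div_eq_mul_one_div]
    gcongr
    linarith
  rw [log_dl] at hup
  have h1 := log_en_le (nn j)
  have h2 := (abs_le.1 (hC3 j)).2
  have h3 := hC1 j
  have h4 := hC2 (nn j)
  unfold Bd
  linarith


open Classical in
def gd (A : ℝ) (N : ℕ) (b : ℕ → Bool) : ℝ := if ∃ n ≤ N, A < Nn n b / en n then 0 else 1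

lemma gd_nonneg (A : ℝ) (N : ℕ) (b : ℕ → Bool) : 0 ≤ gd A N b := by
  unfold gd; split_ifs <;> norm_num

lemma tilt_factor {i : ℕ} (hi : i.Prime) (t : ℝ) (x : Bool) :
    ‖1 + (sg x : ℂ) * (i:ℂ) ^ (-(1/2 + t * Complex.I : ℂ))‖ ^ 2 =
      (1 + 1 / (i:ℝ)) * (1 + sg x * qq t i) := by
  set y : ℂ := (i:ℂ) ^ (-(1/2 + t * Complex.I : ℂ)) with hy
  have hyre : y.re = rr i * cc t i := by
    unfold rr cc
    rw [← prime_cpow_re i hi.pos (1/2) t, hy]; push_cast; rfl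
  have hyn : ‖y‖ = rr i := by
    rw [hy, Complex.norm_natCast_cpow_of_pos hi.pos]
    simp [rr]
  have hsg2 : (sg x) ^ 2 = 1 := by cases x <;> simp
  have hr2 := rr_sq hi
  have h1 : y.re ^ 2 + y.im ^ 2 = 1 / (i:ℝ) := by
    rw [← hr2, ← hyn, ← Complex.normSq_eq_norm_sq, Complex.normSq_apply]; ring
  rw [← Complex.normSq_eq_norm_sq, Complex.normSq_apply]
  simp only [Complex.add_re, Complex.one_re, Complex.re_ofReal_mul, Complex.add_im, Complex.one_im,
    Complex.im_ofReal_mul, qq, hi, if_true]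
  have hp := inv_pos' hi
  have : (1 + 1 / (i:ℝ)) * (1 + sg x * (2 * rr i * cc t i / (1 + 1 / (i:ℝ)))) =
    1 + 1 / (i:ℝ) + sg x * (2 * (rr i * cc t i)) := by
    have h0 : (1 + 1 / (i:ℝ)) ≠ 0 := by positivity
    generalize (1 + 1 / (i:ℝ)) = u at *
    field_simp
  rw [this, ← hyre, ← h1]
  linear_combination (y.re ^ 2 + y.im ^ 2) * hsg2

lemma tilt (N : ℕ) (t : ℝ) (g : (ℕ → Bool) → ℝ) :
    Ex w0 N (fun b => ‖Ff b N (1/2 + t * Complex.I)‖ ^ 2 * g b) = en N * Ex (wq (qq t)) N g := by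
  have := Ex_tilt w0 (wq (qq t)) N
    (fun i x => if i.Prime then ‖1 + (sg x : ℂ) * (i:ℂ) ^ (-(1/2 + t * Complex.I : ℂ))‖ ^ 2 else 1)
    (fun i => if i.Prime then 1 + 1 / (i:ℝ) else 1) ?_ ?_ g
  · rw [en, ← this]
    congr 1
    funext b
    unfold Ff
    rw [norm_prod, ← Finset.prod_pow]
    congr 1
    refine Finset.prod_congr rfl fun i _ => ?_
    split_ifs <;> simp
  · intro i
    by_cases hi : i.Prime
    · simp only [hi, if_true, tilt_factor hi, w0, wq]; simp; ring
    · simp [hi, w0, wq, qq]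
  · intro i
    by_cases hi : i.Prime
    · simp only [hi, if_true, tilt_factor hi, w0, wq]; simp; ring
    · simp [hi, w0, wq, qq]

lemma Ex_integral (w : ℕ → ℝ) (N : ℕ) (g : ℝ → (ℕ → Bool) → ℝ) (hg : ∀ b, Integrable (fun t => g t b)) :
    Ex w N (fun b => ∫ t, g t b) = ∫ t, Ex w N (g t) ∧ Integrable (fun t => Ex w N (g t)) := by
  induction N generalizing g with
  | zero => exact ⟨rfl, hg _⟩
  | succ N ih =>
    have h := ih (fun t b => w N * g t (Function.update b N true) +
      (1 - w N) * g t (Function.update b N false))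
      (fun b => ((hg _).const_mul _).add ((hg _).const_mul _))
    refine ⟨?_, h.2⟩
    simp only [Ex]
    rw [← h.1]
    congr 1
    funext b
    rw [integral_add ((hg _).const_mul _) ((hg _).const_mul _), integral_const_mul, integral_const_mul]

lemma half_norm_sq (t : ℝ) : ‖(1/2 + t * Complex.I : ℂ)‖ ^ 2 = 1/4 + t ^ 2 := by
  rw [← Complex.normSq_eq_norm_sq, Complex.normSq_apply]
  simp; ring

lemma inv_half_le (t : ℝ) : 1 / ‖(1/2 + t * Complex.I : ℂ)‖ ^ 2 ≤ 8 * (1 + |t|) ^ (-2:ℝ) := by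
  rw [half_norm_sq]
  have h : 0 < 1 + |t| := by positivity
  rw [Real.rpow_neg h.le, ← div_eq_mul_inv, div_le_div_iff₀ (by positivity) (by positivity)]
  norm_num
  nlinarith [sq_abs t, sq_nonneg (1 - |t|)]

lemma Lam_le (t : ℝ) : Lam t ≤ 4 * (1 + |t|) ^ (1/2:ℝ) := by
  unfold Lam
  have h : 0 ≤ |t| := abs_nonneg t
  have h1 : Real.log (2 + |t|) ≤ Real.log 2 + Real.log (1 + |t|) := by
    rw [← Real.log_mul (by norm_num) (by positivity)]
    exact Real.log_le_log (by positivity) (by linarith)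
  have h2 := Real.log_le_rpow_div (x := 1 + |t|) (ε := 1/2) (by positivity) (by norm_num)
  have h3 := Real.one_le_rpow (x := 1 + |t|) (z := 1/2) (by linarith) (by norm_num)
  have h4 := Real.log_two_lt_d9
  linarith

lemma Lam_div_le (t : ℝ) : Lam t / ‖(1/2 + t * Complex.I : ℂ)‖ ^ 2 ≤ 32 * (1 + |t|) ^ (-(3/2):ℝ) := by
  have h : 0 < 1 + |t| := by positivity
  have h1 := mul_le_mul (Lam_le t) (inv_half_le t) (by positivity) (by positivity)
  have e : (1 + |t|) ^ (-(3/2):ℝ) = (1 + |t|) ^ (1/2:ℝ) * (1 + |t|) ^ (-2:ℝ) := by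
    rw [← Real.rpow_add h]; norm_num
  rw [div_eq_mul_one_div, e]
  linarith

lemma int_tail (r : ℝ) (hr : 1 < r) : Integrable (fun t : ℝ => (1 + |t|) ^ (-r)) := by
  have := integrable_one_add_norm (E := ℝ) (μ := volume) (r := r) (by simpa using hr)
  simpa using this

lemma meas_half : Measurable (fun t : ℝ => ‖(1/2 + t * Complex.I : ℂ)‖ ^ 2) := by fun_prop

lemma Ff_half_cont (b : ℕ → Bool) (N : ℕ) :
    Continuous (fun t : ℝ => Ff b N (1/2 + t * Complex.I)) := by
  unfold Ff
  refine continuous_finsetProd _ fun i _ => ?_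
  split_ifs with hi
  · have : (i:ℂ) ≠ 0 := by exact_mod_cast hi.ne_zero
    refine continuous_const.add (continuous_const.mul ?_)
    refine Continuous.const_cpow (by fun_prop) (Or.inl this)
  · exact continuous_const

lemma Ff_half_bound (b : ℕ → Bool) (N : ℕ) (t : ℝ) : ‖Ff b N (1/2 + t * Complex.I)‖ ≤ 2 ^ N := by
  unfold Ff
  rw [norm_prod]
  have : (2:ℝ) ^ N = ∏ i ∈ Finset.range N, 2 := by simp
  rw [this]
  refine Finset.prod_le_prod (fun i _ => norm_nonneg _) fun i _ => ?_
  split_ifs with hi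
  · refine (norm_add_le _ _).trans ?_
    rw [norm_mul, Complex.norm_real, Real.norm_eq_abs, abs_sg, one_mul,
      Complex.norm_natCast_cpow_of_pos hi.pos]
    have h1 : (1:ℝ) ≤ i := by exact_mod_cast hi.one_lt.le
    have := Real.rpow_le_one_of_one_le_of_nonpos h1 (z := (-(1/2 + t * Complex.I : ℂ)).re) (by simp)
    rw [norm_one]; linarith
  · simp

lemma I_int (b : ℕ → Bool) (N : ℕ) : Integrable (fun t : ℝ =>
    ‖Ff b N (1/2 + t * Complex.I)‖ ^ 2 / ‖(1/2 + t * Complex.I : ℂ)‖ ^ 2) := by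
  refine Integrable.mono' ((int_tail 2 (by norm_num)).const_mul ((2 ^ N) ^ 2 * 8)) ?_ ?_
  · exact ((((Ff_half_cont b N).norm.pow 2).measurable).div meas_half).aestronglyMeasurable
  · refine Filter.Eventually.of_forall fun t => ?_
    rw [Real.norm_of_nonneg (by positivity), div_eq_mul_one_div, mul_assoc]
    gcongr
    · exact Ff_half_bound b N t
    · exact inv_half_le t

def II (N : ℕ) (b : ℕ → Bool) : ℝ := ∫ t : ℝ,
    ‖Ff b N (1/2 + t * Complex.I)‖ ^ 2 / ‖(1/2 + t * Complex.I : ℂ)‖ ^ 2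

theorem second_moment : ∃ C : ℝ, 0 ≤ C ∧ ∀ A : ℝ, 1 ≤ A → ∀ K N : ℕ, 1 ≤ K → nn K ≤ N →
    Ex w0 N (fun b => II N b * gd A N b) ≤ C * (1 + Real.log A) * en N / √K := by
  obtain ⟨CB, hCB, hbar⟩ := barrier
  obtain ⟨C, hC0, hC⟩ := ballot CB hCB
  refine ⟨C * ∫ t : ℝ, 32 * (1 + |t|) ^ (-(3/2):ℝ), by positivity, fun A hA K N hK hN => ?_⟩
  have hA0 : 0 ≤ Real.log A := Real.log_nonneg hA
  have hen := en_pos N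
  have hgs : ∀ t b, gd A N b ≤ surv (LL t) (Bd CB A t) K b := by
    intro t b
    unfold gd
    split_ifs with h
    · exact surv_nonneg _ _
    · push Not at h
      unfold surv
      rw [if_pos]
      intro i hi
      exact hbar A t hA b i (h _ ((nn_mono hi.le).trans hN))
  have e : (fun b => II N b * gd A N b) = fun b => ∫ t : ℝ, 
      ‖Ff b N (1/2 + t * Complex.I)‖ ^ 2 / ‖(1/2 + t * Complex.I : ℂ)‖ ^ 2 * gd A N b := by
    funext b
    rw [II, integral_mul_const]
  have hI := Ex_integral w0 N (fun t b => ‖Ff b N (1/2 + t * Complex.I)‖ ^ 2 /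
    ‖(1/2 + t * Complex.I : ℂ)‖ ^ 2 * gd A N b) (fun b => (I_int b N).mul_const _)
  rw [e, hI.1]
  have e2 : C * (∫ t : ℝ, 32 * (1 + |t|) ^ (-(3/2):ℝ)) * (1 + Real.log A) * en N / √K =
      ∫ t : ℝ, (C * (1 + Real.log A) * en N / √K) * (32 * (1 + |t|) ^ (-(3/2):ℝ)) := by
    rw [integral_const_mul (C * (1 + Real.log A) * en N / √K)]; ring
  rw [e2]
  refine integral_mono hI.2 (((int_tail (3/2) (by norm_num)).const_mul 32).const_mul _) fun t => ?_
  have e3 : (fun b => ‖Ff b N (1/2 + t * Complex.I)‖ ^ 2 /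
    ‖(1/2 + t * Complex.I : ℂ)‖ ^ 2 * gd A N b) = fun b => (1 / ‖(1/2 + t * Complex.I : ℂ)‖ ^ 2) *
      (‖Ff b N (1/2 + t * Complex.I)‖ ^ 2 * gd A N b) := by
    funext b; ring
  simp only []
  rw [e3, Ex_mul_left, tilt]
  have h1 := (Ex_mono (wq_nonneg (qq_sq_le t)) (wq_le_one (qq_sq_le t)) N (hgs t)).trans
    (hC A t hA K N hK hN)
  have hLam := Lam_ge t
  calc (1 / ‖(1/2 + t * Complex.I : ℂ)‖ ^ 2) * (en N * Ex (wq (qq t)) N (gd A N))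
      ≤ (1 / ‖(1/2 + t * Complex.I : ℂ)‖ ^ 2) * (en N * (C * ((1 + Real.log A) * Lam t) / √K)) := by
        gcongr
        refine h1.trans ?_
        gcongr
        nlinarith
    _ = (C * (1 + Real.log A) * en N / √K) * (Lam t / ‖(1/2 + t * Complex.I : ℂ)‖ ^ 2) := by ring
    _ ≤ _ := by
        gcongr
        exact Lam_div_le t

open Classical in
theorem tail_bound : ∃ C : ℝ, 0 ≤ C ∧ ∀ A B : ℝ, 1 ≤ A → 0 < B → ∀ K N : ℕ, 1 ≤ K → nn K ≤ N →
    Ex w0 N (fun b => if B < II N b then 1 else 0) ≤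
      1 / A + C * (1 + Real.log A) * en N / (√K * B) := by
  obtain ⟨C, hC0, hC⟩ := second_moment
  refine ⟨C, hC0, fun A B hA hB K N hK hN => ?_⟩
  have h1 := good_prob A N
  have h2 := hC A hA K N hK hN
  have hA0 : 0 < A := by linarith
  have h3 := Ex_mono w0_nonneg w0_le_one N (g := fun b => if B < II N b then (1:ℝ) else 0)
    (h := fun b => (if ∃ n ≤ N, A < Nn n b / en n then (1:ℝ) else 0) +
      (1 / B) * (II N b * gd A N b)) ?_
  · rw [Ex_add, Ex_mul_left] at h3
    refine h3.trans (add_le_add ?_ ?_)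
    · rw [le_div_iff₀ hA0, mul_comm]; exact h1
    · calc _ ≤ (1 / B) * (C * (1 + Real.log A) * en N / √K) := by gcongr
        _ = _ := by rw [one_div, ← div_eq_inv_mul, div_div]
  · intro b
    have hI : 0 ≤ II N b := integral_nonneg fun t => by positivity
    unfold gd
    split_ifs with h4 h5 h6
    · simp
    · rw [zero_add, mul_one, one_div, ← div_eq_inv_mul, one_le_div hB]; exact h4.le
    · simp
    · simp; positivity


lemma meas_dep {α : Type*} [MeasurableSpace α] {N : ℕ} (ψ : α → ℕ → Bool)
    (hψ : ∀ i < N, Measurable (fun x => ψ x i)) {h : (ℕ → Bool) → ℝ} (hh : Dep N h) :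
    Measurable (fun x => h (ψ x)) := by
  have e : (fun x => h (ψ x)) = (fun y : Fin N → Bool => h (fun i => if hi : i < N then y ⟨i, hi⟩ else true)) ∘
      (fun x (i : Fin N) => ψ x i) := by
    funext x
    refine hh _ _ fun i hi => ?_
    simp [hi]
  rw [e]
  exact (measurable_of_countable _).comp (measurable_pi_lambda _ fun i => hψ i i.2)

lemma bdd_dep {N : ℕ} {h : (ℕ → Bool) → ℝ} (hh : Dep N h) : ∃ C, ∀ b, ‖h b‖ ≤ C := by
  refine ⟨∑ y : Fin N → Bool, ‖h (fun i => if hi : i < N then y ⟨i, hi⟩ else true)‖, fun b => ?_⟩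
  have e : h b = h (fun i => if hi : i < N then (fun i : Fin N => b i) ⟨i, hi⟩ else true) := by
    refine hh _ _ fun i hi => ?_
    simp [hi]
  rw [e]
  exact Finset.single_le_sum (f := fun y : Fin N → Bool =>
    ‖h (fun i => if hi : i < N then y ⟨i, hi⟩ else true)‖) (fun y _ => norm_nonneg _)
    (Finset.mem_univ (fun i : Fin N => b i))

open Classical in
def bb {Ω : Type*} (f : Ω → ℕ → ℝ) (ω : Ω) (i : ℕ) : Bool := decide (¬ i.Prime ∨ f ω i = 1)

section
variable {Ω : Type*} [MeasurableSpace Ω] {μ : Measure Ω} [IsProbabilityMeasure μ]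
  {f : Ω → ℕ → ℝ}

lemma bb_meas (hf : IsRademacherRMF μ f) (i : ℕ) : Measurable (fun ω => bb f ω i) := by
  refine measurable_to_bool ?_
  have : (fun ω => bb f ω i) ⁻¹' {true} = {ω | ¬ i.Prime} ∪ (fun ω => f ω i) ⁻¹' {1} := by
    ext ω; simp [bb]
  rw [this]
  exact (MeasurableSet.const _).union (hf.meas i (measurableSet_singleton 1))

lemma bb_dep_int (hf : IsRademacherRMF μ f) {N : ℕ} {h : (ℕ → Bool) → ℝ} (hh : Dep N h) :
    Integrable (fun ω => h (bb f ω)) μ := by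
  obtain ⟨C, hC⟩ := bdd_dep hh
  exact Integrable.of_bound (meas_dep (bb f) (fun i _ => bb_meas hf i) hh).aestronglyMeasurable C
    (Filter.Eventually.of_forall fun ω => hC _)

open Classical in
lemma bb_indep (hf : IsRademacherRMF μ f) {N : ℕ} (hN : N.Prime) {h : (ℕ → Bool) → ℝ} (hh : Dep N h) :
    IndepFun (fun ω => h (bb f ω)) (fun ω => if bb f ω N then (1:ℝ) else 0) μ := by
  let S : Finset Nat.Primes := (Finset.range N).subtype Nat.Prime
  let T : Finset Nat.Primes := {⟨N, hN⟩}
  have hdisj : Disjoint S T := by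
    rw [Finset.disjoint_left]
    intro p hp hpT
    replace hpT := Finset.mem_singleton.1 hpT
    have h1 : (p:ℕ) ∈ Finset.range N := Finset.mem_subtype.1 hp
    rw [hpT] at h1
    simp at h1
  have hind := hf.indep.indepFun_finset S T hdisj (fun p => hf.meas p)
  have hmem : ∀ i : ℕ, ∀ hi : i.Prime, i < N → (⟨i, hi⟩ : Nat.Primes) ∈ S := by
    intro i hi hlt
    exact Finset.mem_subtype.2 (Finset.mem_range.2 hlt)
  let ψ : (S → ℝ) → ℕ → Bool := fun x i =>
    if hi : ∃ hp : i.Prime, i < N then decide (x ⟨⟨i, hi.1⟩, hmem i hi.1 hi.2⟩ = 1) else true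
  have hψ : ∀ i < N, Measurable (fun x => ψ x i) := by
    intro i hi
    by_cases hp : i.Prime
    · have hex : ∃ hp : i.Prime, i < N := ⟨hp, hi⟩
      have e : (fun x => ψ x i) = fun x => decide (x ⟨⟨i, hp⟩, hmem i hp hi⟩ = 1) := by
        funext x
        simp only [ψ]
        rw [dif_pos hex]
      rw [e]
      refine measurable_to_bool ?_
      have : (fun x : S → ℝ => decide (x ⟨⟨i, hp⟩, hmem i hp hi⟩ = 1)) ⁻¹' {true} =
        (fun x : S → ℝ => x ⟨⟨i, hp⟩, hmem i hp hi⟩) ⁻¹' {1} := by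
        ext x; simp
      rw [this]
      exact measurable_pi_apply _ (measurableSet_singleton 1)
    · have e : (fun x => ψ x i) = fun x => true := by
        funext x
        simp only [ψ]
        rw [dif_neg]
        rintro ⟨h1, _⟩; exact hp h1
      rw [e]; exact measurable_const
  let φ : (T → ℝ) → ℝ := fun x => if x ⟨⟨N, hN⟩, Finset.mem_singleton_self _⟩ = 1 then 1 else 0
  have hφ : Measurable φ := by
    refine Measurable.ite ?_ measurable_const measurable_const
    exact measurable_pi_apply (⟨⟨N, hN⟩, Finset.mem_singleton_self _⟩ : T) (measurableSet_singleton 1)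
  have := hind.comp (meas_dep ψ hψ hh) hφ
  convert this using 1
  · funext ω
    refine hh _ _ fun i hi => ?_
    simp only [ψ, bb]
    by_cases hp : i.Prime
    · have hex : ∃ hp : i.Prime, i < N := ⟨hp, hi⟩
      rw [dif_pos hex]
      simp [hp]
    · rw [dif_neg]
      · simp [hp]
      · rintro ⟨h1, _⟩; exact hp h1
  · funext ω
    simp [φ, bb, hN]

lemma integral_ind (hf : IsRademacherRMF μ f) {N : ℕ} (hN : N.Prime) :
    ∫ ω, (if bb f ω N then (1:ℝ) else 0) ∂μ = 1/2 := by
  have e : (fun ω => if bb f ω N then (1:ℝ) else 0) = Set.indicator {ω | f ω N = 1} 1 := by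
    funext ω
    simp [bb, hN, Set.indicator_apply]
  have hms : MeasurableSet {ω | f ω N = 1} := hf.meas N (measurableSet_singleton 1)
  rw [e, integral_indicator_one hms, Measure.real, hf.prob_one N hN]
  simp

theorem integral_bb (hf : IsRademacherRMF μ f) (N : ℕ) (g : (ℕ → Bool) → ℝ) (hg : Dep N g) :
    ∫ ω, g (bb f ω) ∂μ = Ex w0 N g := by
  induction N generalizing g with
  | zero =>
    have : ∀ ω, g (bb f ω) = g (fun _ => false) := fun ω => hg _ _ (fun i hi => by omega)
    simp [this, Ex]
  | succ N ih =>
    have hD : ∀ x, Dep N (fun b => g (Function.update b N x)) := by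
      intro x b b' hb
      refine hg _ _ fun i hi => ?_
      by_cases hiN : i = N
      · subst hiN; simp
      · simp [hiN, hb i (by omega)]
    simp only [Ex]
    rw [← ih _ (((hD true).comp₂ (hD false) (fun x y => w0 N * x + (1 - w0 N) * y)))]
    by_cases hN : N.Prime
    · have e : ∀ ω, g (bb f ω) = g (Function.update (bb f ω) N true) * (if bb f ω N then (1:ℝ) else 0)
          + (g (Function.update (bb f ω) N false) -
            g (Function.update (bb f ω) N false) * (if bb f ω N then (1:ℝ) else 0)) := by
        intro ω
        have h1 : Function.update (bb f ω) N (bb f ω N) = bb f ω := Function.update_eq_self _ _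
        cases hb : bb f ω N
        · rw [hb] at h1; simp [h1]
        · rw [hb] at h1; simp [h1]
      have hm : ∀ x, ∫ ω, g (Function.update (bb f ω) N x) * (if bb f ω N then (1:ℝ) else 0) ∂μ =
          (∫ ω, g (Function.update (bb f ω) N x) ∂μ) * (1/2) := by
        intro x
        rw [← integral_ind hf hN]
        refine (bb_indep hf hN (hD x)).integral_fun_mul_eq_mul_integral
          (bb_dep_int hf (hD x)).aestronglyMeasurable ?_
        refine (Measurable.ite ?_ measurable_const measurable_const).aestronglyMeasurable
        exact bb_meas hf N (measurableSet_singleton true)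
      have hi : ∀ x, Integrable (fun ω => g (Function.update (bb f ω) N x)) μ := fun x =>
        bb_dep_int hf (hD x)
      have hii : ∀ x, Integrable (fun ω => g (Function.update (bb f ω) N x) *
          (if bb f ω N then (1:ℝ) else 0)) μ := by
        intro x
        have hDD : Dep (N+1) (fun b : ℕ → Bool => g (Function.update b N x) *
            (if b N then (1:ℝ) else 0)) := by
          intro b b' hb
          have h1 := hD x b b' (fun i hi => hb i (by omega))
          simp only at h1
          simp only [h1, hb N (by omega)]
        exact bb_dep_int hf hDD
      simp_rw [e]
      have hsub : Integrable (fun ω => g (Function.update (bb f ω) N false) -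
          g (Function.update (bb f ω) N false) * (if bb f ω N then (1:ℝ) else 0)) μ :=
        (hi _).sub (hii _)
      rw [integral_add (hii _) hsub, integral_sub (hi _) (hii _), hm, hm,
        integral_add ((hi _).const_mul _) ((hi _).const_mul _), integral_const_mul, integral_const_mul]
      simp only [w0, hN, if_true]
      ring
    · have e : ∀ ω, g (Function.update (bb f ω) N true) = g (bb f ω) := by
        intro ω
        have h1 : bb f ω N = true := by simp [bb, hN]
        rw [← h1, Function.update_eq_self]
      simp [w0, hN, e]

lemma ae_pm (hf : IsRademacherRMF μ f) : ∀ᵐ ω ∂μ, ∀ p : ℕ, p.Prime → f ω p = sg (bb f ω p) := by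
  rw [ae_all_iff]
  intro p
  by_cases hp : p.Prime
  · have m1 : MeasurableSet {ω | f ω p = 1} := hf.meas p (measurableSet_singleton 1)
    have m2 : MeasurableSet {ω | f ω p = -1} := hf.meas p (measurableSet_singleton (-1))
    have hd : Disjoint {ω | f ω p = 1} {ω | f ω p = -1} := by
      rw [Set.disjoint_left]
      intro ω h1 h2
      simp only [Set.mem_ofPred_eq] at h1 h2
      rw [h1] at h2; norm_num at h2
    have h1 : μ ({ω | f ω p = 1} ∪ {ω | f ω p = -1}) = 1 := by
      rw [measure_union hd m2, hf.prob_one p hp, hf.prob_neg_one p hp, one_div]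
      exact ENNReal.inv_two_add_inv_two
    have h2 : ∀ᵐ ω ∂μ, ω ∈ {ω | f ω p = 1} ∪ {ω | f ω p = -1} := by
      rw [← prob_compl_eq_zero_iff (m1.union m2)] at h1
      exact h1
    filter_upwards [h2] with ω h _
    rcases h with h | h
    · simp only [Set.mem_ofPred_eq] at h
      simp [bb, hp, h]
    · simp only [Set.mem_ofPred_eq] at h
      simp [bb, hp, h]
      norm_num
  · exact Filter.Eventually.of_forall fun ω h => absurd h hp

lemma eulerProd_eq {ω : Ω} (h : ∀ p : ℕ, p.Prime → f ω p = sg (bb f ω p)) (x t : ℝ) :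
    eulerProd f ω x t = Ff (bb f ω) (⌊x⌋₊ + 1) (1/2 + t * Complex.I) := by
  unfold eulerProd Ff
  have e : (Finset.Icc 1 ⌊x⌋₊).filter Nat.Prime = (Finset.range (⌊x⌋₊ + 1)).filter Nat.Prime := by
    ext p
    simp only [Finset.mem_filter, Finset.mem_Icc, Finset.mem_range]
    constructor
    · rintro ⟨⟨h1, h2⟩, h3⟩; exact ⟨by omega, h3⟩
    · rintro ⟨h1, h3⟩; exact ⟨⟨h3.one_lt.le, by omega⟩, h3⟩
  rw [e, Finset.prod_filter]
  refine Finset.prod_congr rfl fun p _ => ?_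
  split_ifs with hp
  · rw [h p hp, neg_add']
  · rfl

lemma Ff_dep (N : ℕ) (s : ℂ) : Dep N (fun b => Ff b N s) := by
  intro b b' hb
  unfold Ff
  refine Finset.prod_congr rfl fun i hi => ?_
  rw [hb i (Finset.mem_range.1 hi)]

lemma II_dep (N : ℕ) : Dep N (II N) := by
  intro b b' hb
  unfold II
  congr 1
  funext t
  have := Ff_dep N (1/2 + t * Complex.I) b b' hb
  simp only at this
  rw [this]

open Classical in
lemma prob_eq (hf : IsRademacherRMF μ f) (x B : ℝ) :
    μ ({ω | (∫ t : ℝ, ‖eulerProd f ω x t‖ ^ 2 /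
              ‖(1 / 2 : ℂ) + (t : ℂ) * Complex.I‖ ^ 2) ≤ B}ᶜ) =
      ENNReal.ofReal (Ex w0 (⌊x⌋₊ + 1) (fun b => if B < II (⌊x⌋₊ + 1) b then 1 else 0)) := by
  set N := ⌊x⌋₊ + 1 with hN
  have hm : Measurable (fun ω => II N (bb f ω)) := meas_dep (bb f) (fun i _ => bb_meas hf i) (II_dep N)
  have hd : Dep N (fun b => if B < II N b then (1:ℝ) else 0) :=
    (II_dep N).comp (fun y => if B < y then (1:ℝ) else 0)
  rw [← integral_bb hf N _ hd]
  have hset : MeasurableSet {ω | B < II N (bb f ω)} := measurableSet_lt measurable_const hm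
  have e : (fun ω => if B < II N (bb f ω) then (1:ℝ) else 0) =
      Set.indicator {ω | B < II N (bb f ω)} 1 := by
    funext ω; simp [Set.indicator_apply]
  rw [e, integral_indicator_one hset, Measure.real, ENNReal.ofReal_toReal (measure_ne_top _ _)]
  refine measure_congr ?_
  filter_upwards [ae_pm hf] with ω hω
  have : (∫ t : ℝ, ‖eulerProd f ω x t‖ ^ 2 /
              ‖(1 / 2 : ℂ) + (t : ℂ) * Complex.I‖ ^ 2) = II N (bb f ω) := by
    unfold II
    simp only [eulerProd_eq hω, hN]
  apply propext
  change ¬ (_ ≤ B) ↔ B < _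
  rw [this, not_le]
end

theorem final_bound : ∃ C : ℝ, 0 < C ∧ ∀ m T : ℝ, 1 ≤ m → 1 ≤ T → 
    open Classical in
    Ex w0 (⌊Real.exp (2 ^ m)⌋₊ + 1) (fun b => if √T * 2 ^ m / √m < II (⌊Real.exp (2 ^ m)⌋₊ + 1) b
      then 1 else 0) ≤ C * T ^ (-(1/4:ℝ)) := by
  obtain ⟨C, hC0, hC⟩ := tail_bound
  obtain ⟨C2, hC20, hC2⟩ := inv_prime_sum
  refine ⟨1 + C * Real.exp C2 * 2, by positivity, fun m T hm hT => ?_⟩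
  set N := ⌊Real.exp (2 ^ m)⌋₊ + 1 with hN
  have hT0 : 0 < T := by linarith
  have hm0 : 0 < m := by linarith
  set d : ℝ := 2 ^ (-m) with hd
  have hd0 : 0 < d := by positivity
  have hd1 : d ≤ 1 := Real.rpow_le_one_of_one_le_of_nonpos (by norm_num) (by linarith)
  have hdi : 1 / d = 2 ^ m := by rw [hd, Real.rpow_neg (by norm_num), one_div, inv_inv]
  have hNc : N = cut d := by rw [hN, cut, hdi]
  have hen : en N ≤ Real.exp C2 * 2 ^ m := by
    have h1 := log_en_le N
    have h2 := (abs_le.1 (hC2 d hd0 hd1)).2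
    have h3 : Real.log (en N) ≤ C2 + Real.log (2 ^ m) := by
      rw [← hdi]
      rw [hNc] at h1 ⊢
      have : PS (cut d) (fun i => 1 / (i:ℝ)) = ∑ i ∈ Finset.range (cut d), if i.Prime then 1 / (i:ℝ) else 0 := rfl
      linarith
    rw [Real.log_le_iff_le_exp (en_pos N), Real.exp_add, Real.exp_log (by positivity)] at h3
    exact h3
  set J := ⌊m⌋₊ with hJ
  have hJ1 : 1 ≤ J := Nat.one_le_floor_iff m |>.2 hm
  have hJm : (J:ℝ) ≤ m := Nat.floor_le hm0.le
  have hJ2 : m ≤ 4 * J := by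
    have := Nat.lt_floor_add_one m
    have : (1:ℝ) ≤ J := by exact_mod_cast hJ1
    linarith
  have hnn : nn J ≤ N := by
    rw [hN, nn, cut]
    gcongr
    rw [dl, one_div, one_div, inv_pow, inv_inv, ← Real.rpow_natCast]
    exact Real.rpow_le_rpow_of_exponent_le (by norm_num) hJm
  set A : ℝ := T ^ (1/4:ℝ) with hA
  have hA1 : 1 ≤ A := Real.one_le_rpow hT (by norm_num)
  have hA0 : 0 < A := by linarith
  set B : ℝ := √T * 2 ^ m / √m with hB
  have hB0 : 0 < B := by positivity
  refine (hC A B hA1 hB0 J N hJ1 hnn).trans ?_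
  have hTA : T ^ (-(1/4:ℝ)) = 1 / A := by rw [Real.rpow_neg hT0.le, ← hA, one_div A]
  have hsT : √T = A * A := by
    rw [hA, ← Real.rpow_add hT0, Real.sqrt_eq_rpow]; norm_num
  have hlog : 1 + Real.log A ≤ A := by linarith [Real.log_le_sub_one_of_pos hA0]
  have hlog0 : 0 ≤ 1 + Real.log A := by linarith [Real.log_nonneg hA1]
  have hsm : √m ≤ 2 * √J := by
    have : √(4 * (J:ℝ)) = 2 * √J := by
      rw [Real.sqrt_mul (by norm_num), show (4:ℝ) = 2 ^ 2 by norm_num, Real.sqrt_sq (by norm_num)]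
    rw [← this]; exact Real.sqrt_le_sqrt hJ2
  have hJp : 0 < √(J:ℝ) := Real.sqrt_pos.2 (by exact_mod_cast hJ1)
  have hmp : 0 < √m := Real.sqrt_pos.2 hm0
  rw [hTA, add_mul, one_mul]
  gcongr
  have hJB : A * A * 2 ^ m / 2 ≤ √J * B := by
    rw [hB, hsT, ← mul_div_assoc, div_le_div_iff₀ (by norm_num) hmp]
    have : 0 ≤ A * A * 2 ^ m := by positivity
    nlinarith
  have hen0 := (en_pos N).le
  calc C * (1 + Real.log A) * en N / (√J * B)
      ≤ C * A * (Real.exp C2 * 2 ^ m) / (A * A * 2 ^ m / 2) := by gcongr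
    _ = C * Real.exp C2 * 2 * (1 / A) := by field_simp

/-- For every `T ≥ 1` and sufficiently large `ℓ`, the complement of the event
`Σ_ℓ = {∫_ℝ |S_{X_{ℓ-1}}(1/2+it)|²/|1/2+it|² dt ≤ √T 2^{(ℓ-1)^K}/√((ℓ-1)^K)}`
has probability `≪_ε T^{-1/4}`. -/
theorem event_Sigma_rademacher
    {Ω : Type*} [MeasurableSpace Ω] (μ : Measure Ω) [IsProbabilityMeasure μ]
    (f : Ω → ℕ → ℝ) (hf : IsRademacherRMF μ f) :
    ∃ ε₀ : ℝ, 0 < ε₀ ∧ ∀ ε : ℝ, 0 < ε → ε < ε₀ →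
      ∃ C : ℝ, 0 < C ∧ ∃ L : ℕ, ∀ ℓ : ℕ, L ≤ ℓ → 2 ≤ ℓ → ∀ T : ℝ, 1 ≤ T →
        μ ({ω | (∫ t : ℝ, ‖eulerProd f ω (Xpt ε ((ℓ : ℝ) - 1)) t‖ ^ 2 /
              ‖(1 / 2 : ℂ) + (t : ℂ) * Complex.I‖ ^ 2) ≤
            Real.sqrt T * (2 : ℝ) ^ (((ℓ : ℝ) - 1) ^ (1 / (4 * ε))) /
              Real.sqrt (((ℓ : ℝ) - 1) ^ (1 / (4 * ε)))}ᶜ) ≤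
          ENNReal.ofReal (C * T ^ (-(1 / 4 : ℝ))) := by
  classical
  obtain ⟨C, hC, h⟩ := final_bound
  refine ⟨1, one_pos, fun ε hε _ => ⟨C, hC, 2, fun ℓ _ hℓ T hT => ?_⟩⟩
  have hl : (1:ℝ) ≤ (ℓ:ℝ) - 1 := by
    have : (2:ℝ) ≤ ℓ := by exact_mod_cast hℓ
    linarith
  rw [prob_eq hf, Xpt]
  refine ENNReal.ofReal_le_ofReal ?_
  have := h (((ℓ:ℝ) - 1) ^ (1 / (4 * ε))) T (Real.one_le_rpow hl (by positivity)) hT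
  convert this using 4
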